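/- limsup_{n→∞} ψ(φ(n))/(n · log log n) = (6/π²)·e^γ, where γ is the Euler–Mascheroni constant. -/

import Mathlib

open Filter Real

/-- The Dedekind `ψ` function: `ψ(n) = n * ∏_{p ∣ n} (1 + 1/p)`,
i.e. `ψ(p^a) = p^(a-1) * (p + 1)` multiplicatively. -/
def dedekindPsi (n : ℕ) : ℕ := n.factorization.prod fun p a => p ^ (a - 1) * (p + 1)

/-- The coefficient `-log (1 - 1/p)` at primes `p`, and `0` elsewhere. -/
noncomputable def primeLogWeight (k : ℕ) : ℝ := if k.Prime then -Real.log (1 - 1 / k) else 0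

theorem log_one_sub_inv_bounds {x : ℝ} (hx1 : x < 1) :
    x ≤ -Real.log (1 - x) ∧ -Real.log (1 - x) ≤ x / (1 - x) := by
  constructor
  · have := Real.log_le_sub_one_of_pos (show 0 < 1 - x by linarith)
    linarith
  · have h := Real.one_sub_inv_le_log_of_pos (show 0 < 1 - x by linarith)
    have : x / (1 - x) = (1 - x)⁻¹ - 1 := by
      have : (1 - x) ≠ 0 := by linarith
      field_simp
      ring
    linarith

theorem primeLogWeight_nonneg (k : ℕ) : 0 ≤ primeLogWeight k := by
  unfold primeLogWeight
  split_ifs with h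
  · have h2 : (2 : ℝ) ≤ k := by exact_mod_cast h.two_le
    have h3 : (1 : ℝ) / k < 1 := by rw [div_lt_one] <;> linarith
    have h4 : (0 : ℝ) ≤ 1 / k := by positivity
    linarith [(log_one_sub_inv_bounds h3).1]
  · exact le_rfl

theorem primeLogWeight_prime_bounds {p : ℕ} (hp : p.Prime) :
    1 / (p : ℝ) ≤ primeLogWeight p ∧ primeLogWeight p ≤ 1 / ((p : ℝ) - 1) := by
  have h2 : (2 : ℝ) ≤ p := by exact_mod_cast hp.two_le
  have h3 : (1 : ℝ) / p < 1 := by rw [div_lt_one] <;> linarith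
  have h4 : (0 : ℝ) ≤ 1 / p := by positivity
  have h := log_one_sub_inv_bounds h3
  have e : (1 : ℝ) / p / (1 - 1 / p) = 1 / (p - 1) := by
    have : (p : ℝ) - 1 ≠ 0 := by linarith
    field_simp
  simp only [primeLogWeight, hp, if_true]
  rw [e] at h
  exact h

theorem log_factorial_eq_sum (N : ℕ) :
    Real.log (N.factorial : ℝ) =
      ∑ p ∈ Nat.primesLE N, (N.factorial.factorization p : ℝ) * Real.log p := by
  have h := Nat.prod_factorization_pow_eq_self N.factorial_ne_zero
  conv_lhs => rw [← h]
  rw [Finsupp.prod, Nat.cast_prod, Real.log_prod]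
  · simp only [Nat.cast_pow, Real.log_pow]
    apply Finset.sum_subset
    · intro p hp
      rw [Nat.support_factorization, Nat.mem_primeFactors] at hp
      rw [Nat.mem_primesLE]
      exact ⟨(hp.1.dvd_factorial).1 hp.2.1, hp.1⟩
    · intro p _ hp
      rw [Finsupp.notMem_support_iff] at hp
      simp [hp]
  · intro p hp
    rw [Nat.support_factorization, Nat.mem_primeFactors] at hp
    have := hp.1.pos
    positivity

theorem sum_log_div_prime_le {N : ℕ} (hN : 1 ≤ N) :
    ∑ p ∈ Nat.primesLE N, Real.log p / p ≤ Real.log N + Real.log 4 := by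
  have hN0 : (0 : ℝ) < N := by exact_mod_cast hN
  have h1 : ∀ p ∈ Nat.primesLE N, (N : ℝ) * (Real.log p / p) - Real.log p ≤
      (N.factorial.factorization p : ℝ) * Real.log p := by
    intro p hp
    rw [Nat.mem_primesLE] at hp
    have hp0 : (0 : ℝ) < p := by exact_mod_cast hp.2.pos
    have hlog : 0 ≤ Real.log p := Real.log_natCast_nonneg p
    have h2 : N / p ≤ N.factorial.factorization p := by
      rw [Nat.factorization_factorial hp.2 (Nat.lt_succ_self (Nat.log p N))]
      have : 1 ≤ Nat.log p N := Nat.log_pos hp.2.one_lt hp.1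
      calc N / p = N / p ^ 1 := by rw [pow_one]
        _ ≤ _ := Finset.single_le_sum (f := fun i => N / p ^ i) (fun _ _ => Nat.zero_le _)
          (Finset.mem_Ico.2 ⟨le_rfl, by lia⟩)
    have h3 : (N : ℝ) / p - 1 ≤ (N / p : ℕ) := by
      have := Nat.lt_floor_add_one ((N : ℝ) / p)
      rw [Nat.floor_div_eq_div] at this
      linarith
    have h4 : ((N / p : ℕ) : ℝ) ≤ (N.factorial.factorization p : ℝ) := by exact_mod_cast h2
    calc (N : ℝ) * (Real.log p / p) - Real.log p = ((N : ℝ) / p - 1) * Real.log p := by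
          field_simp
      _ ≤ _ := by gcongr; linarith
  have h5 := Finset.sum_le_sum h1
  rw [← log_factorial_eq_sum, Finset.sum_sub_distrib, ← Finset.mul_sum,
    ← Chebyshev.theta_eq_sum_primesLE_log] at h5
  have h6 := Chebyshev.theta_le_log4_mul_x hN0.le
  have h7 : Real.log (N.factorial : ℝ) ≤ N * Real.log N := by
    rw [← Real.log_pow]
    apply Real.log_le_log
    · exact_mod_cast N.factorial_pos
    · exact_mod_cast Nat.factorial_le_pow N
  have h8 : (N : ℝ) * ∑ p ∈ Nat.primesLE N, Real.log p / p ≤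
      N * (Real.log N + Real.log 4) := by linarith
  exact le_of_mul_le_mul_left h8 hN0

theorem le_sum_log_div_prime_sub_one {N : ℕ} (hN : 1 ≤ N) :
    Real.log N - 1 ≤ ∑ p ∈ Nat.primesLE N, Real.log p / (p - 1) := by
  have hN0 : (0 : ℝ) < N := by exact_mod_cast hN
  have h1 : ∀ p ∈ Nat.primesLE N, (N.factorial.factorization p : ℝ) * Real.log p ≤
      (N : ℝ) * (Real.log p / (p - 1)) := by
    intro p hp
    rw [Nat.mem_primesLE] at hp
    have hp0 : (2 : ℝ) ≤ p := by exact_mod_cast hp.2.two_le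
    have hlog : 0 ≤ Real.log p := Real.log_natCast_nonneg p
    have h2 : (N.factorial.factorization p : ℝ) ≤ (N : ℝ) / (p - 1) := by
      have := Nat.factorization_factorial_le_div_pred hp.2 N
      calc (N.factorial.factorization p : ℝ) ≤ ((N / (p - 1) : ℕ) : ℝ) := by exact_mod_cast this
        _ ≤ (N : ℝ) / ((p - 1 : ℕ) : ℝ) := Nat.cast_div_le
        _ = _ := by rw [Nat.cast_sub hp.2.one_le, Nat.cast_one]
    calc _ ≤ (N : ℝ) / (p - 1) * Real.log p := by gcongr
      _ = _ := by ring
  have h5 := Finset.sum_le_sum h1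
  rw [← log_factorial_eq_sum, ← Finset.mul_sum] at h5
  have h7 : N * Real.log N - N ≤ Real.log (N.factorial : ℝ) := by
    have h8 := Stirling.le_log_factorial_stirling (n := N) (by lia)
    have : 0 ≤ Real.log N := Real.log_natCast_nonneg N
    have : 0 ≤ Real.log (2 * π) := Real.log_nonneg (by linarith [Real.pi_gt_three])
    linarith
  have h8 : (N : ℝ) * (Real.log N - 1) ≤
      N * ∑ p ∈ Nat.primesLE N, Real.log p / (p - 1) := by linarith
  exact le_of_mul_le_mul_left h8 hN0

theorem exists_sum_log_div_mul_pred_le :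
    ∃ K : ℝ, ∀ N : ℕ, ∑ p ∈ Nat.primesLE N, Real.log p / (p * (p - 1)) ≤ K := by
  have hs : Summable fun n : ℕ => 4 * (n : ℝ) ^ (-(3 / 2) : ℝ) :=
    (Real.summable_nat_rpow.2 (by norm_num)).mul_left 4
  refine ⟨∑' n : ℕ, 4 * (n : ℝ) ^ (-(3 / 2) : ℝ), fun N => ?_⟩
  refine le_trans (Finset.sum_le_sum fun p hp => ?_)
    (hs.sum_le_tsum (Nat.primesLE N) fun _ _ => by positivity)
  rw [Nat.mem_primesLE] at hp
  have h2 : (2 : ℝ) ≤ p := by exact_mod_cast hp.2.two_le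
  have h3 : Real.log p ≤ 2 * (p : ℝ) ^ (1 / 2 : ℝ) := by
    have := Real.log_le_rpow_div (x := p) (by linarith) (ε := 1 / 2) (by norm_num)
    linarith
  have h4 : (0 : ℝ) < (p : ℝ) ^ (1 / 2 : ℝ) := by positivity
  calc Real.log p / (p * (p - 1)) ≤ (2 * (p : ℝ) ^ (1 / 2 : ℝ)) / (p * (p / 2)) := by
        gcongr
        linarith
    _ = 4 * ((p : ℝ) ^ (1 / 2 : ℝ) / (p : ℝ) ^ (2 : ℝ)) := by
        rw [Real.rpow_two]
        field_simp
        norm_num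
    _ = _ := by
        rw [← Real.rpow_sub (by linarith)]
        norm_num

theorem sum_Icc_primeLogWeight_mul (g : ℕ → ℝ) (N : ℕ) :
    ∑ k ∈ Finset.Icc 0 N, g k * primeLogWeight k =
      ∑ p ∈ Nat.primesLE N, g p * primeLogWeight p := by
  symm
  apply Finset.sum_subset
  · intro p hp
    rw [Nat.mem_primesLE] at hp
    simp [hp.1]
  · intro k hk hk'
    rw [Finset.mem_Icc] at hk
    have : ¬ k.Prime := fun h => hk' (Nat.mem_primesLE.2 ⟨hk.2, h⟩)
    simp [primeLogWeight, this]

theorem exists_abs_sum_log_mul_primeLogWeight_sub_log_le :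
    ∃ K : ℝ, ∀ N : ℕ, 1 ≤ N →
      |∑ k ∈ Finset.Icc 0 N, Real.log k * primeLogWeight k - Real.log N| ≤ K := by
  obtain ⟨K, hK⟩ := exists_sum_log_div_mul_pred_le
  refine ⟨K + 1 + Real.log 4, fun N hN => ?_⟩
  rw [sum_Icc_primeLogWeight_mul (fun k => Real.log k)]
  have hd : ∑ p ∈ Nat.primesLE N, Real.log p / ((p : ℝ) - 1) =
      ∑ p ∈ Nat.primesLE N, Real.log p / p + ∑ p ∈ Nat.primesLE N, Real.log p / (p * (p - 1)) := by
    rw [← Finset.sum_add_distrib]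
    refine Finset.sum_congr rfl fun p hp => ?_
    rw [Nat.mem_primesLE] at hp
    have h2 : (2 : ℝ) ≤ p := by exact_mod_cast hp.2.two_le
    have : (p : ℝ) - 1 ≠ 0 := by linarith
    field_simp
    ring
  have h1 : ∑ p ∈ Nat.primesLE N, Real.log p / p ≤
      ∑ p ∈ Nat.primesLE N, Real.log p * primeLogWeight p := by
    refine Finset.sum_le_sum fun p hp => ?_
    rw [Nat.mem_primesLE] at hp
    rw [div_eq_mul_one_div]
    exact mul_le_mul_of_nonneg_left (primeLogWeight_prime_bounds hp.2).1
      (Real.log_natCast_nonneg p)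
  have h2 : ∑ p ∈ Nat.primesLE N, Real.log p * primeLogWeight p ≤
      ∑ p ∈ Nat.primesLE N, Real.log p / ((p : ℝ) - 1) := by
    refine Finset.sum_le_sum fun p hp => ?_
    rw [Nat.mem_primesLE] at hp
    rw [div_eq_mul_one_div]
    exact mul_le_mul_of_nonneg_left (primeLogWeight_prime_bounds hp.2).2
      (Real.log_natCast_nonneg p)
  have h3 := sum_log_div_prime_le hN
  have h4 := le_sum_log_div_prime_sub_one hN
  have h5 := hK N
  have h6 : 0 ≤ Real.log 4 := Real.log_nonneg (by norm_num)
  rw [abs_le]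
  constructor <;> linarith

section

open MeasureTheory Set Topology

/-- Partial sums of `primeLogWeight`. -/
noncomputable def primeLogSum (x : ℝ) : ℝ := ∑ k ∈ Finset.Icc 0 ⌊x⌋₊, primeLogWeight k

theorem primeLogSum_mono : Monotone primeLogSum := by
  intro x y hxy
  unfold primeLogSum
  apply Finset.sum_le_sum_of_subset_of_nonneg
  · exact Finset.Icc_subset_Icc le_rfl (Nat.floor_mono hxy)
  · intro k _ _
    exact primeLogWeight_nonneg k

theorem primeLogSum_nonneg (x : ℝ) : 0 ≤ primeLogSum x :=
  Finset.sum_nonneg fun k _ => primeLogWeight_nonneg k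

theorem hasDerivAt_inv_log_of_one_lt {t : ℝ} (ht : 1 < t) :
    HasDerivAt (fun t => (Real.log t)⁻¹) (-(1 / (t * Real.log t ^ 2))) t := by
  have hl := Real.log_pos ht
  refine ((Real.hasDerivAt_log (by linarith : t ≠ 0)).fun_inv hl.ne').congr_deriv ?_
  field_simp

theorem continuousOn_one_div_mul_log_sq :
    ContinuousOn (fun t : ℝ => 1 / (t * Real.log t ^ 2)) (Ici 2) := by
  apply ContinuousOn.div continuousOn_const
  · apply continuousOn_id.mul
    apply ContinuousOn.pow
    apply Real.continuousOn_log.mono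
    intro t ht
    simp only [mem_Ici] at ht
    simp only [mem_compl_iff, mem_singleton_iff]
    linarith
  · intro t ht
    simp only [mem_Ici] at ht
    have := Real.log_pos (show 1 < t by linarith)
    positivity

theorem integrableOn_one_div_mul_log_sq :
    IntegrableOn (fun t : ℝ => 1 / (t * Real.log t ^ 2)) (Ioi 2) := by
  apply integrableOn_Ioi_deriv_of_nonneg' (g := fun t => -(Real.log t)⁻¹) (l := 0)
  · intro t ht
    simp only [mem_Ici] at ht
    exact ((hasDerivAt_inv_log_of_one_lt (show 1 < t by linarith)).fun_neg).congr_deriv (neg_neg _)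
  · intro t ht
    simp only [mem_Ioi] at ht
    positivity
  · simpa using (tendsto_inv_atTop_zero.comp Real.tendsto_log_atTop).neg

theorem exists_tendsto_primeLogSum_sub :
    ∃ C : ℝ, Tendsto (fun x => primeLogSum x - Real.log (Real.log x)) atTop (𝓝 C) := by
  obtain ⟨K, hK⟩ := exists_abs_sum_log_mul_primeLogWeight_sub_log_le
  set E : ℝ → ℝ := fun t => ∑ k ∈ Finset.Icc 0 ⌊t⌋₊, Real.log k * primeLogWeight k with hE
  set R : ℝ → ℝ := fun t => E t - Real.log t with hR
  have hRb : ∀ t, 2 ≤ t → |R t| ≤ K + Real.log 2 := by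
    intro t ht
    have h1 : 1 ≤ ⌊t⌋₊ := Nat.le_floor (by norm_num; linarith)
    have h1' : (1 : ℝ) ≤ ⌊t⌋₊ := by exact_mod_cast h1
    have h2 := hK _ h1
    have h3 := Nat.floor_le (show 0 ≤ t by linarith)
    have h4 := Nat.lt_floor_add_one t
    have h5 : Real.log (⌊t⌋₊ : ℝ) ≤ Real.log t := Real.log_le_log (by linarith) h3
    have h6 : Real.log t ≤ Real.log 2 + Real.log (⌊t⌋₊ : ℝ) := by
      rw [← Real.log_mul (by norm_num) (by linarith)]
      exact Real.log_le_log (by linarith) (by linarith)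
    rw [abs_le] at h2 ⊢
    have h7 : 0 ≤ Real.log 2 := Real.log_nonneg (by norm_num)
    simp only [hR, hE]
    constructor <;> linarith
  have hEmono : Monotone E := by
    intro x y hxy
    apply Finset.sum_le_sum_of_subset_of_nonneg
    · exact Finset.Icc_subset_Icc le_rfl (Nat.floor_mono hxy)
    · intro k _ _
      exact mul_nonneg (Real.log_natCast_nonneg k) (primeLogWeight_nonneg k)
  have hRm : Measurable R := hEmono.measurable.sub Real.measurable_log
  have hR_int : IntegrableOn (fun t => R t * (1 / (t * Real.log t ^ 2))) (Ioi 2) := by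
    apply Integrable.bdd_mul (c := K + Real.log 2) integrableOn_one_div_mul_log_sq
      hRm.aestronglyMeasurable
    filter_upwards [ae_restrict_mem measurableSet_Ioi] with t ht
    rw [Real.norm_eq_abs]
    exact hRb t (le_of_lt ht)
  have habel : ∀ x, 2 ≤ x → primeLogSum x - Real.log (Real.log x) =
      1 + R x * (Real.log x)⁻¹ - Real.log (Real.log 2) +
        ∫ t in (2 : ℝ)..x, R t * (1 / (t * Real.log t ^ 2)) := by
    intro x hx
    have hderiv : ∀ t ∈ Icc 2 x, deriv (fun t => (Real.log t)⁻¹) t =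
        -(1 / (t * Real.log t ^ 2)) := fun t ht =>
      (hasDerivAt_inv_log_of_one_lt (by linarith [ht.1])).deriv
    have hc : ContinuousOn (fun t : ℝ => 1 / (t * Real.log t ^ 2)) (Icc 2 x) :=
      continuousOn_one_div_mul_log_sq.mono fun t ht => ht.1
    have hab := sum_mul_eq_sub_integral_mul₁ (f := fun t => (Real.log t)⁻¹)
      (fun k => Real.log k * primeLogWeight k) (by simp) (by simp) x
      (fun t ht => (hasDerivAt_inv_log_of_one_lt (by linarith [ht.1])).differentiableAt)
      (by
        apply (hc.neg.integrableOn_Icc).congr_fun _ measurableSet_Icc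
        intro t ht
        exact (hderiv t ht).symm)
    have h1 : ∑ k ∈ Finset.Icc 0 ⌊x⌋₊, (fun t => (Real.log t)⁻¹) (k : ℝ) *
        (Real.log k * primeLogWeight k) = primeLogSum x := by
      refine Finset.sum_congr rfl fun k _ => ?_
      by_cases hk : k.Prime
      · have : 0 < Real.log k := Real.log_pos (by exact_mod_cast hk.one_lt)
        field_simp
      · simp [primeLogWeight, hk]
    rw [h1] at hab
    have hlx : 0 < Real.log x := Real.log_pos (by linarith)
    have h2 : ∫ t in Ioc 2 x, deriv (fun t => (Real.log t)⁻¹) t *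
        ∑ k ∈ Finset.Icc 0 ⌊t⌋₊, Real.log k * primeLogWeight k =
        -((∫ t in (2 : ℝ)..x, (t * Real.log t)⁻¹) +
          ∫ t in (2 : ℝ)..x, R t * (1 / (t * Real.log t ^ 2))) := by
      have hi1 : IntervalIntegrable (fun t : ℝ => (t * Real.log t)⁻¹) volume 2 x := by
        apply ContinuousOn.intervalIntegrable_of_Icc hx
        apply ContinuousOn.inv₀
        · apply continuousOn_id.mul
          apply Real.continuousOn_log.mono
          intro t ht
          simp only [mem_compl_iff, mem_singleton_iff]
          linarith [ht.1]
        · intro t ht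
          have := Real.log_pos (show 1 < t by linarith [ht.1])
          have := ht.1
          positivity
      have hi2 : IntervalIntegrable (fun t => R t * (1 / (t * Real.log t ^ 2))) volume 2 x := by
        rw [intervalIntegrable_iff_integrableOn_Ioc_of_le hx]
        exact hR_int.mono_set Ioc_subset_Ioi_self
      rw [← intervalIntegral.integral_add hi1 hi2, intervalIntegral.integral_of_le hx,
        ← integral_neg]
      apply setIntegral_congr_fun measurableSet_Ioc
      intro t ht
      have hl := Real.log_pos (show 1 < t by linarith [ht.1])
      have ht0 : 0 < t := by linarith [ht.1]
      simp only [hR, hE]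
      rw [hderiv t ⟨ht.1.le, ht.2⟩]
      field_simp
      ring
    have h3 : ∫ t in (2 : ℝ)..x, (t * Real.log t)⁻¹ =
        Real.log (Real.log x) - Real.log (Real.log 2) := by
      apply intervalIntegral.integral_eq_sub_of_hasDerivAt (f := fun t => Real.log (Real.log t))
      · intro t ht
        rw [uIcc_of_le hx] at ht
        have hl := Real.log_pos (show 1 < t by linarith [ht.1])
        exact ((Real.hasDerivAt_log (show t ≠ 0 by linarith [ht.1])).log hl.ne').congr_deriv
          (by rw [mul_inv, div_eq_mul_inv])
      · apply ContinuousOn.intervalIntegrable_of_Icc hx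
        apply ContinuousOn.inv₀
        · apply continuousOn_id.mul
          apply Real.continuousOn_log.mono
          intro t ht
          simp only [mem_compl_iff, mem_singleton_iff]
          linarith [ht.1]
        · intro t ht
          have := Real.log_pos (show 1 < t by linarith [ht.1])
          have := ht.1
          positivity
    rw [h2, h3] at hab
    have h4 : (Real.log x)⁻¹ * ∑ k ∈ Finset.Icc 0 ⌊x⌋₊, Real.log k * primeLogWeight k =
        1 + R x * (Real.log x)⁻¹ := by
      simp only [hR, hE]
      field_simp
      ring
    rw [h4] at hab
    rw [hab]
    ring
  have hlim1 : Tendsto (fun x => R x * (Real.log x)⁻¹) atTop (𝓝 0) := by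
    apply bdd_le_mul_tendsto_zero' (K + Real.log 2)
    · filter_upwards [eventually_ge_atTop 2] with t ht using hRb t ht
    · exact tendsto_inv_atTop_zero.comp Real.tendsto_log_atTop
  have hlim2 := intervalIntegral_tendsto_integral_Ioi 2 hR_int tendsto_id
  refine ⟨1 + 0 - Real.log (Real.log 2) +
    ∫ t in Ioi (2 : ℝ), R t * (1 / (t * Real.log t ^ 2)), ?_⟩
  refine ((((tendsto_const_nhds (x := (1 : ℝ))).add hlim1).sub_const _).add hlim2).congr' ?_
  filter_upwards [eventually_ge_atTop 2] with x hx
  exact (habel x hx).symm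

theorem abs_log_le_rpow_add {u : ℝ} (hu : 0 < u) : |Real.log u| ≤ 2 * u ^ (-(1 / 2) : ℝ) + u := by
  have h1 : Real.log u ≤ u := by linarith [Real.log_le_sub_one_of_pos hu]
  have h2 : -Real.log u ≤ 2 * u ^ (-(1 / 2) : ℝ) := by
    rw [← Real.log_inv, Real.rpow_neg hu.le, ← Real.inv_rpow hu.le]
    have := Real.log_le_rpow_div (inv_pos.mpr hu).le (show (0 : ℝ) < 1 / 2 by norm_num)
    linarith
  have h3 : 0 < u ^ (-(1 / 2) : ℝ) := Real.rpow_pos_of_pos hu _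
  rw [abs_le]
  constructor <;> linarith

theorem integrableOn_exp_neg_Ioi_zero : IntegrableOn (fun u : ℝ => Real.exp (-u)) (Ioi 0) := by
  simpa using Real.GammaIntegral_convergent (show (0 : ℝ) < 1 by norm_num)

theorem integrableOn_abs_log_mul_exp_neg :
    IntegrableOn (fun u : ℝ => |Real.log u| * Real.exp (-u)) (Ioi 0) := by
  have h := ((Real.GammaIntegral_convergent (show (0 : ℝ) < 1 / 2 by norm_num)).const_mul 2).add
    (Real.GammaIntegral_convergent (show (0 : ℝ) < 2 by norm_num))
  refine Integrable.mono' h (by fun_prop) ?_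
  filter_upwards [ae_restrict_mem measurableSet_Ioi] with u hu
  have h1 := abs_log_le_rpow_add hu
  rw [Real.norm_eq_abs, abs_mul, abs_abs, abs_of_pos (Real.exp_pos _)]
  simp only [Pi.add_apply]
  norm_num
  have h2 := mul_le_mul_of_nonneg_right h1 (Real.exp_pos (-u)).le
  norm_num at h2 ⊢
  linarith

theorem integrableOn_log_mul_exp_neg :
    IntegrableOn (fun u : ℝ => Real.log u * Real.exp (-u)) (Ioi 0) := by
  refine Integrable.mono' integrableOn_abs_log_mul_exp_neg (by fun_prop) ?_
  refine ae_of_all _ fun u => ?_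
  rw [Real.norm_eq_abs, abs_mul, abs_of_pos (Real.exp_pos _)]

theorem integral_log_mul_exp_neg :
    ∫ u in Ioi (0 : ℝ), Real.log u * Real.exp (-u) = -Real.eulerMascheroniConstant := by
  have h1 := Complex.hasDerivAt_GammaIntegral (s := 1) (by simp)
  have h2 := h1.congr_of_eventuallyEq (f₁ := Complex.Gamma) (by
    filter_upwards [(isOpen_lt continuous_const Complex.continuous_re).mem_nhds
      (show (0 : ℝ) < (1 : ℂ).re by simp)] with s hs
    exact Complex.Gamma_eq_integral hs)
  have h3 := h2.unique Complex.hasDerivAt_Gamma_one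
  simp only [sub_self, Complex.cpow_zero, one_mul] at h3
  have h4 : ∀ t : ℝ, (Real.log t : ℂ) * (Real.exp (-t) : ℂ) =
      ((Real.log t * Real.exp (-t) : ℝ) : ℂ) := by
    intro t; push_cast; rfl
  simp only [h4] at h3
  rw [integral_complex_ofReal] at h3
  exact_mod_cast h3

theorem primeLogWeight_le (k : ℕ) : primeLogWeight k ≤ 2 / k := by
  by_cases hk : k.Prime
  · have h2 : (2 : ℝ) ≤ k := by exact_mod_cast hk.two_le
    refine (primeLogWeight_prime_bounds hk).2.trans ?_
    rw [div_le_div_iff₀ (by linarith) (by linarith)]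
    linarith
  · simp only [primeLogWeight, hk, if_false]
    positivity

theorem summable_primeLogWeight_mul_rpow {σ : ℝ} (hσ : 0 < σ) :
    Summable fun k : ℕ => primeLogWeight k * (k : ℝ) ^ (-σ) := by
  refine Summable.of_nonneg_of_le
    (fun k => mul_nonneg (primeLogWeight_nonneg k) (Real.rpow_nonneg k.cast_nonneg _)) ?_
    ((Real.summable_nat_rpow_inv.mpr (show 1 < 1 + σ by linarith)).mul_left 2)
  intro k
  rcases Nat.eq_zero_or_pos k with rfl | hk
  · simp [primeLogWeight]; positivity
  · have hk' : (0 : ℝ) < k := by exact_mod_cast hk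
    refine (mul_le_mul_of_nonneg_right (primeLogWeight_le k)
      (Real.rpow_nonneg k.cast_nonneg _)).trans
      (le_of_eq ?_)
    rw [Real.rpow_add hk', Real.rpow_neg hk'.le, Real.rpow_one, mul_inv]
    ring

theorem integral_primeLogSum_mul_exp_neg {σ : ℝ} (hσ : 0 < σ) :
    ∫ u in Ioi (0 : ℝ), primeLogSum (Real.exp (u / σ)) * Real.exp (-u) =
      ∑' k : ℕ, primeLogWeight k * (k : ℝ) ^ (-σ) := by
  set F : ℕ → ℝ → ℝ := fun k u =>
    (Ici (σ * Real.log k)).indicator (fun u => primeLogWeight k * Real.exp (-u)) u with hF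
  have hFint : ∀ k, IntegrableOn (F k) (Ioi 0) := fun k =>
    (integrableOn_exp_neg_Ioi_zero.const_mul _).indicator measurableSet_Ici
  have hFval : ∀ k, ∫ u in Ioi (0 : ℝ), F k u = primeLogWeight k * (k : ℝ) ^ (-σ) := by
    intro k
    by_cases hk : k.Prime
    · have hk0 : (0 : ℝ) < k := by exact_mod_cast hk.pos
      have hl : 0 < Real.log k := Real.log_pos (by exact_mod_cast hk.one_lt)
      have : Ioi (0 : ℝ) ∩ Ici (σ * Real.log k) = Ici (σ * Real.log k) := by
        apply inter_eq_self_of_subset_right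
        intro u hu
        exact lt_of_lt_of_le (by positivity) (mem_Ici.mp hu)
      rw [setIntegral_indicator measurableSet_Ici, this, integral_Ici_eq_integral_Ioi,
        integral_const_mul, integral_exp_neg_Ioi, Real.rpow_def_of_pos hk0]
      congr 2
      ring
    · simp [hF, primeLogWeight, hk]
  have hFnn : ∀ k u, 0 ≤ F k u := fun k u =>
    indicator_nonneg (fun u _ => mul_nonneg (primeLogWeight_nonneg k) (Real.exp_pos _).le) u
  have hs := hasSum_integral_of_summable_integral_norm (μ := volume.restrict (Ioi 0)) hFint (by
    simp only [Real.norm_of_nonneg (hFnn _ _), hFval]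
    exact summable_primeLogWeight_mul_rpow hσ)
  simp only [hFval] at hs
  rw [hs.tsum_eq]
  apply setIntegral_congr_fun measurableSet_Ioi
  intro u hu
  simp only
  rw [tsum_eq_sum (s := Finset.Icc 0 ⌊Real.exp (u / σ)⌋₊), primeLogSum, Finset.sum_mul]
  · refine Finset.sum_congr rfl fun k hk => ?_
    rw [Finset.mem_Icc] at hk
    rcases Nat.eq_zero_or_pos k with rfl | hk0
    · simp [hF, primeLogWeight]
    · have h1 := (Nat.le_floor_iff (Real.exp_pos _).le).mp hk.2
      have h2 := (Real.log_le_iff_le_exp (by exact_mod_cast hk0)).mpr h1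
      rw [le_div_iff₀ hσ] at h2
      simp only [hF]
      rw [indicator_of_mem]
      rw [mem_Ici]; linarith
  · intro k hk
    have h1 : ⌊Real.exp (u / σ)⌋₊ < k := by
      by_contra! h
      exact hk (Finset.mem_Icc.mpr ⟨k.zero_le, h⟩)
    have h2 := (Nat.floor_lt (Real.exp_pos _).le).mp h1
    have h3 := (Real.lt_log_iff_exp_lt (by exact_mod_cast (Nat.zero_le _).trans_lt h1)).mpr h2
    rw [div_lt_iff₀ hσ] at h3
    simp only [hF]
    rw [indicator_of_notMem]
    rw [mem_Ici]; linarith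

theorem tendsto_tsum_primeLogWeight_add_log {C : ℝ}
    (hC : Tendsto (fun x => primeLogSum x - Real.log (Real.log x)) atTop (𝓝 C)) :
    Tendsto (fun σ => (∑' k : ℕ, primeLogWeight k * (k : ℝ) ^ (-σ)) + Real.log σ) (𝓝[>] 0)
      (𝓝 (C - Real.eulerMascheroniConstant)) := by
  have hC' : Tendsto (fun v => primeLogSum (Real.exp v) - Real.log v) atTop (𝓝 C) := by
    have := hC.comp Real.tendsto_exp_atTop
    simpa [Function.comp_def] using this
  obtain ⟨v0, hv0, hv0'⟩ : ∃ v0 : ℝ, 1 ≤ v0 ∧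
      ∀ v ≥ v0, |primeLogSum (Real.exp v) - Real.log v| ≤ |C| + 1 := by
    have := (hC'.abs).eventually (eventually_le_nhds (show |C| < |C| + 1 by linarith))
    obtain ⟨v0, h⟩ := eventually_atTop.mp this
    exact ⟨max 1 v0, le_max_left _ _, fun v hv => h v ((le_max_right _ _).trans hv)⟩
  set K := |C| + 1 + primeLogSum (Real.exp v0) + Real.log v0 with hKdef
  have hP0 := primeLogSum_nonneg (Real.exp v0)
  have hL0 := Real.log_nonneg hv0
  have hbound : ∀ σ ∈ Ioo (0 : ℝ) 1, ∀ u ∈ Ioi (0 : ℝ),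
      |primeLogSum (Real.exp (u / σ)) - Real.log (u / σ)| ≤ K + |Real.log u| := by
    intro σ hσ u hu
    have hu : 0 < u := hu
    have hσ0 := hσ.1
    rcases le_total v0 (u / σ) with h | h
    · have := hv0' _ h
      have := abs_nonneg (Real.log u)
      linarith
    · have h1 := primeLogSum_nonneg (Real.exp (u / σ))
      have h2 := primeLogSum_mono (Real.exp_le_exp.mpr h)
      have h3 : Real.log u ≤ Real.log (u / σ) :=
        Real.log_le_log hu (by rw [le_div_iff₀ hσ0]; nlinarith [hσ.2])
      have h4 : Real.log (u / σ) ≤ Real.log v0 := Real.log_le_log (by positivity) h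
      have h5 := neg_abs_le (Real.log u)
      have h6 := abs_nonneg (Real.log u)
      have h7 := abs_nonneg C
      rw [abs_le]
      constructor <;> linarith
  have hmeasP : Measurable primeLogSum := primeLogSum_mono.measurable
  have hdom := tendsto_integral_filter_of_dominated_convergence (μ := volume.restrict (Ioi 0))
    (l := 𝓝[>] (0 : ℝ))
    (F := fun σ u => (primeLogSum (Real.exp (u / σ)) - Real.log (u / σ)) * Real.exp (-u))
    (f := fun u => C * Real.exp (-u))
    (fun u => K * Real.exp (-u) + |Real.log u| * Real.exp (-u))
    (Eventually.of_forall fun σ => by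
      apply Measurable.aestronglyMeasurable
      have : Measurable fun u : ℝ => primeLogSum (Real.exp (u / σ)) :=
        hmeasP.comp (by fun_prop)
      fun_prop)
    (by
      filter_upwards [Ioo_mem_nhdsGT (show (0 : ℝ) < 1 by norm_num)] with σ hσ
      filter_upwards [ae_restrict_mem measurableSet_Ioi] with u hu
      rw [Real.norm_eq_abs, abs_mul, abs_of_pos (Real.exp_pos _), ← add_mul]
      exact mul_le_mul_of_nonneg_right (hbound σ hσ u hu) (Real.exp_pos _).le)
    ((integrableOn_exp_neg_Ioi_zero.const_mul K).add integrableOn_abs_log_mul_exp_neg)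
    (by
      filter_upwards [ae_restrict_mem measurableSet_Ioi] with u hu
      refine Tendsto.mul_const _ (hC'.comp ?_)
      show Tendsto (fun σ : ℝ => u * σ⁻¹) _ _
      exact tendsto_inv_nhdsGT_zero.const_mul_atTop hu)
  have hone : ∫ u in Ioi (0 : ℝ), Real.exp (-u) = 1 := by
    rw [integral_exp_neg_Ioi]; simp
  rw [integral_const_mul, hone, mul_one] at hdom
  refine ((hdom.sub_const Real.eulerMascheroniConstant)).congr' ?_
  filter_upwards [Ioo_mem_nhdsGT (show (0 : ℝ) < 1 by norm_num)] with σ hσ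
  have hi1 : IntegrableOn (fun u => (primeLogSum (Real.exp (u / σ)) - Real.log (u / σ)) *
      Real.exp (-u)) (Ioi 0) := by
    refine Integrable.mono' (g := fun u => K * Real.exp (-u) + |Real.log u| * Real.exp (-u))
      ((integrableOn_exp_neg_Ioi_zero.const_mul K).add integrableOn_abs_log_mul_exp_neg) ?_ ?_
    · apply Measurable.aestronglyMeasurable
      have : Measurable fun u : ℝ => primeLogSum (Real.exp (u / σ)) :=
        hmeasP.comp (by fun_prop)
      fun_prop
    · filter_upwards [ae_restrict_mem measurableSet_Ioi] with u hu
      rw [Real.norm_eq_abs, abs_mul, abs_of_pos (Real.exp_pos _), ← add_mul]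
      exact mul_le_mul_of_nonneg_right (hbound σ hσ u hu) (Real.exp_pos _).le
  have hi2 := integrableOn_log_mul_exp_neg
  have hi3 := integrableOn_exp_neg_Ioi_zero.const_mul (Real.log σ)
  rw [← integral_primeLogSum_mul_exp_neg hσ.1]
  have : ∫ u in Ioi (0 : ℝ), primeLogSum (Real.exp (u / σ)) * Real.exp (-u) =
      ∫ u in Ioi (0 : ℝ), ((primeLogSum (Real.exp (u / σ)) - Real.log (u / σ)) * Real.exp (-u) +
        (Real.log u * Real.exp (-u) - Real.log σ * Real.exp (-u))) := by
    apply setIntegral_congr_fun measurableSet_Ioi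
    intro u hu
    simp only
    rw [Real.log_div (ne_of_gt hu) hσ.1.ne']
    ring
  have hi23 : IntegrableOn (fun u => Real.log u * Real.exp (-u) - Real.log σ * Real.exp (-u))
      (Ioi 0) := hi2.sub hi3
  rw [this, integral_add hi1 hi23, integral_sub hi2 hi3, integral_log_mul_exp_neg,
    integral_const_mul, hone]
  ring

end

section

open Topology Set

theorem neg_log_one_sub_mul_add_bound {x y : ℝ} (hx0 : 0 ≤ x) (hx : x ≤ 1 / 2) (hy0 : 0 ≤ y)
    (hy : y ≤ 1) : |-Real.log (1 - x * y) - -Real.log (1 - x) * y| ≤ 2 * x ^ 2 := by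
  have hxy : x * y ≤ 1 / 2 := by nlinarith
  have hxy0 : 0 ≤ x * y := by positivity
  obtain ⟨h1, h2⟩ := log_one_sub_inv_bounds (show x < 1 by linarith)
  obtain ⟨h3, h4⟩ := log_one_sub_inv_bounds (show x * y < 1 by linarith)
  have key : ∀ z : ℝ, 0 ≤ z → z ≤ 1 / 2 → z / (1 - z) ≤ z + 2 * z ^ 2 := by
    intro z hz0 hz
    rw [div_le_iff₀ (by linarith)]
    nlinarith [mul_nonneg hz0 hz0, mul_nonneg (mul_nonneg hz0 hz0) (by linarith : 0 ≤ 1 - 2 * z)]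
  have h5 := key x hx0 hx
  have h6 := key _ hxy0 hxy
  have h7 := mul_le_mul_of_nonneg_right h1 hy0
  have h8 := mul_le_mul_of_nonneg_right (h2.trans h5) hy0
  have h9 : (x * y) ^ 2 ≤ x ^ 2 := pow_le_pow_left₀ hxy0 (by nlinarith) 2
  have h10 : x ^ 2 * y ≤ x ^ 2 := mul_le_of_le_one_right (by positivity) hy
  rw [abs_le]
  constructor <;> nlinarith

theorem exp_tsum_neg_log_eq_norm_riemannZeta {σ : ℝ} (hσ : 0 < σ) :
    Real.exp (∑' p : Nat.Primes, -Real.log (1 - (p : ℝ)⁻¹ * (p : ℝ) ^ (-σ))) =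
      ‖riemannZeta (1 + σ)‖ := by
  have h := riemannZeta_eulerProduct_exp_log (s := 1 + σ) (by simpa using hσ)
  have h2 : ∀ p : Nat.Primes, -Complex.log (1 - (p : ℂ) ^ (-(1 + σ : ℂ))) =
      ((-Real.log (1 - (p : ℝ)⁻¹ * (p : ℝ) ^ (-σ)) : ℝ) : ℂ) := by
    intro p
    have hp0 : (0 : ℝ) < p := by exact_mod_cast p.prop.pos
    have hp1 : (1 : ℝ) < p := by exact_mod_cast p.prop.one_lt
    have h3 : (p : ℝ)⁻¹ * (p : ℝ) ^ (-σ) = (p : ℝ) ^ (-(1 + σ)) := by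
      rw [neg_add, Real.rpow_add hp0, Real.rpow_neg_one]
    have h4 : (p : ℝ) ^ (-(1 + σ)) ≤ 1 :=
      (Real.rpow_lt_one_of_one_lt_of_neg hp1 (by linarith)).le
    rw [h3, Complex.ofReal_neg, Complex.ofReal_log (by linarith)]
    push_cast
    rw [Complex.ofReal_cpow hp0.le]
    push_cast
    rfl
  simp only [h2] at h
  rw [← Complex.ofReal_tsum] at h
  rw [← h, Complex.norm_exp_ofReal]

theorem tendsto_tsum_neg_log_add_log :
    Tendsto (fun σ : ℝ => (∑' p : Nat.Primes, -Real.log (1 - (p : ℝ)⁻¹ * (p : ℝ) ^ (-σ))) +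
      Real.log σ) (𝓝[>] 0) (𝓝 0) := by
  have h1 : Tendsto (fun σ : ℝ => (1 + σ : ℂ)) (𝓝[>] 0) (𝓝[≠] 1) := by
    apply tendsto_nhdsWithin_iff.mpr
    constructor
    · have : Continuous fun σ : ℝ => (1 + σ : ℂ) := by fun_prop
      have := this.tendsto 0
      simp only [Complex.ofReal_zero, add_zero] at this
      exact this.mono_left nhdsWithin_le_nhds
    · filter_upwards [self_mem_nhdsWithin] with σ hσ
      have : σ ≠ 0 := ne_of_gt hσ
      simpa using this
  have h2 := ((riemannZeta_residue_one.comp h1).norm.log (by simp))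
  simp only [norm_one, Real.log_one] at h2
  refine h2.congr' ?_
  filter_upwards [self_mem_nhdsWithin] with σ hσ
  have hσ : 0 < σ := hσ
  simp only [Function.comp_apply, add_sub_cancel_left, norm_mul, Complex.norm_real,
    Real.norm_of_nonneg hσ.le, ← exp_tsum_neg_log_eq_norm_riemannZeta hσ]
  rw [Real.log_mul hσ.ne' (Real.exp_pos _).ne', Real.log_exp, add_comm]

theorem tsum_primeLogWeight_mul_rpow_eq (σ : ℝ) :
    ∑' k : ℕ, primeLogWeight k * (k : ℝ) ^ (-σ) =
      ∑' p : Nat.Primes, -Real.log (1 - (p : ℝ)⁻¹) * (p : ℝ) ^ (-σ) := by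
  have h : ∀ p : Nat.Primes, -Real.log (1 - (p : ℝ)⁻¹) * (p : ℝ) ^ (-σ) =
      (fun k : ℕ => primeLogWeight k * (k : ℝ) ^ (-σ)) p := by
    intro p
    simp [primeLogWeight, p.prop]
  simp only [h]
  symm
  apply tsum_subtype_eq_of_support_subset (s := {p : ℕ | p.Prime})
    (f := fun k : ℕ => primeLogWeight k * (k : ℝ) ^ (-σ))
  intro k hk
  by_contra h
  have h : ¬ k.Prime := h
  simp [primeLogWeight, h] at hk

theorem summable_inv_sq_primes : Summable fun p : Nat.Primes => 2 * ((p : ℝ)⁻¹) ^ 2 := by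
  have : Summable fun k : ℕ => 2 * ((k : ℝ)⁻¹) ^ 2 := by
    simp only [inv_pow]
    exact (Real.summable_nat_pow_inv.mpr (by norm_num)).mul_left 2
  exact this.comp_injective Subtype.val_injective

theorem prime_term_bound {σ : ℝ} (hσ : 0 < σ) (p : Nat.Primes) :
    ‖-Real.log (1 - (p : ℝ)⁻¹ * (p : ℝ) ^ (-σ)) - -Real.log (1 - (p : ℝ)⁻¹) * (p : ℝ) ^ (-σ)‖ ≤
      2 * ((p : ℝ)⁻¹) ^ 2 := by
  have hp2 : (2 : ℝ) ≤ p := by exact_mod_cast p.prop.two_le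
  apply neg_log_one_sub_mul_add_bound (by positivity)
  · rw [one_div]; exact inv_anti₀ (by norm_num) hp2
  · positivity
  · exact (Real.rpow_lt_one_of_one_lt_of_neg (by linarith) (by linarith)).le

theorem tendsto_tsum_sub_zero :
    Tendsto (fun σ : ℝ => ∑' p : Nat.Primes, (-Real.log (1 - (p : ℝ)⁻¹ * (p : ℝ) ^ (-σ)) -
      -Real.log (1 - (p : ℝ)⁻¹) * (p : ℝ) ^ (-σ))) (𝓝[>] 0) (𝓝 0) := by
  have h := tendsto_tsum_of_dominated_convergence (𝓕 := 𝓝[>] (0 : ℝ))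
    (f := fun (σ : ℝ) (p : Nat.Primes) => (-Real.log (1 - (p : ℝ)⁻¹ * (p : ℝ) ^ (-σ)) -
      -Real.log (1 - (p : ℝ)⁻¹) * (p : ℝ) ^ (-σ))) (g := fun _ => 0) summable_inv_sq_primes
    (fun p => by
      have hp2 : (2 : ℝ) ≤ p := by exact_mod_cast p.prop.two_le
      have hp : (1 - (p : ℝ)⁻¹) ≠ 0 := by
        have : (p : ℝ)⁻¹ ≤ 2⁻¹ := inv_anti₀ (by norm_num) hp2
        norm_num at this
        linarith
      have h1 : Tendsto (fun σ : ℝ => (p : ℝ) ^ (-σ)) (𝓝[>] 0) (𝓝 1) := by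
        have : ContinuousAt (fun σ : ℝ => (p : ℝ) ^ (-σ)) 0 := by
          apply ContinuousAt.rpow continuousAt_const (by fun_prop) (Or.inl (by linarith))
        have := this.tendsto
        simp only [neg_zero, Real.rpow_zero] at this
        exact this.mono_left nhdsWithin_le_nhds
      have h2 := (((h1.const_mul (p : ℝ)⁻¹).const_sub 1).log (by simpa using hp)).neg.sub
        (h1.const_mul (-Real.log (1 - (p : ℝ)⁻¹)))
      simpa using h2)
    (by
      filter_upwards [self_mem_nhdsWithin] with σ hσ p
      exact prime_term_bound hσ p)
  simpa using h

theorem tendsto_tsum_primeLogWeight_add_log_zero :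
    Tendsto (fun σ => (∑' k : ℕ, primeLogWeight k * (k : ℝ) ^ (-σ)) + Real.log σ) (𝓝[>] 0)
      (𝓝 0) := by
  have h := tendsto_tsum_neg_log_add_log.sub tendsto_tsum_sub_zero
  rw [sub_zero] at h
  refine h.congr' ?_
  filter_upwards [self_mem_nhdsWithin] with σ hσ
  have hs1 : Summable fun p : Nat.Primes => -Real.log (1 - (p : ℝ)⁻¹) * (p : ℝ) ^ (-σ) := by
    have := (summable_primeLogWeight_mul_rpow hσ).comp_injective
      (Subtype.val_injective : Function.Injective (Subtype.val : Nat.Primes → ℕ))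
    refine this.congr fun p => ?_
    simp [primeLogWeight, p.prop]
  have hs2 := Summable.of_norm_bounded summable_inv_sq_primes (prime_term_bound hσ)
  have hs3 := hs2.add hs1
  simp only [sub_add_cancel] at hs3
  rw [hs3.tsum_sub hs1, tsum_primeLogWeight_mul_rpow_eq]
  ring

theorem tendsto_primeLogSum_sub_log_log :
    Tendsto (fun x => primeLogSum x - Real.log (Real.log x)) atTop
      (𝓝 Real.eulerMascheroniConstant) := by
  obtain ⟨C, hC⟩ := exists_tendsto_primeLogSum_sub
  have := tendsto_nhds_unique (tendsto_tsum_primeLogWeight_add_log hC)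
    tendsto_tsum_primeLogWeight_add_log_zero
  rwa [sub_eq_zero.mp this] at hC

/-- The partial product `∏_{p ≤ x} (1 + 1/p)` over the primes. -/
noncomputable def primeProd (x : ℝ) : ℝ := ∏ p ∈ Nat.primesLE ⌊x⌋₊, (1 + 1 / (p : ℝ))

theorem exp_primeLogSum (x : ℝ) :
    Real.exp (primeLogSum x) = ∏ p ∈ Nat.primesLE ⌊x⌋₊, (1 - 1 / (p : ℝ))⁻¹ := by
  have h := sum_Icc_primeLogWeight_mul (fun _ => 1) ⌊x⌋₊
  simp only [one_mul] at h
  rw [primeLogSum, h, Real.exp_sum]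
  refine Finset.prod_congr rfl fun p hp => ?_
  have hp' := (Nat.mem_primesLE.mp hp).2
  have hp1 : (1 : ℝ) < p := by exact_mod_cast hp'.one_lt
  have : 1 / (p : ℝ) < 1 := by rw [div_lt_one (by linarith)]; exact hp1
  simp only [primeLogWeight, hp', if_true]
  rw [Real.exp_neg, Real.exp_log (by linarith)]

theorem tendsto_prod_one_sub_inv_sq :
    Tendsto (fun N : ℕ => ∏ p ∈ Nat.primesLE N, (1 - 1 / (p : ℝ) ^ 2)) atTop
      (𝓝 (6 / Real.pi ^ 2)) := by
  have h := riemannZeta_eulerProduct (s := 2) (by norm_num)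
  rw [riemannZeta_two] at h
  have h1 : ∀ n : ℕ, ∏ p ∈ Nat.primesBelow n, (1 - (p : ℂ) ^ (-2 : ℂ))⁻¹ =
      ((∏ p ∈ Nat.primesBelow n, (1 - 1 / (p : ℝ) ^ 2)⁻¹ : ℝ) : ℂ) := by
    intro n
    push_cast
    refine Finset.prod_congr rfl fun p _ => ?_
    congr 2
    rw [Complex.cpow_neg, one_div]
    norm_cast
  simp only [h1] at h
  have h2 : ((Real.pi : ℂ) ^ 2 / 6) = ((Real.pi ^ 2 / 6 : ℝ) : ℂ) := by push_cast; rfl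
  rw [h2] at h
  have h3 := (Complex.continuous_re.tendsto _).comp h
  simp only [Function.comp_def, Complex.ofReal_re] at h3
  have h4 := (h3.inv₀ (by positivity)).comp (tendsto_add_atTop_nat 1)
  rw [inv_div] at h4
  refine h4.congr fun N => ?_
  simp only [Function.comp_apply, Finset.prod_inv_distrib, inv_inv]
  refine Finset.prod_congr ?_ fun _ _ => rfl
  ext p
  simp [Nat.mem_primesLE, Nat.mem_primesBelow]

theorem tendsto_primeProd_div_log :
    Tendsto (fun x => primeProd x / Real.log x) atTop
      (𝓝 (6 / Real.pi ^ 2 * Real.exp Real.eulerMascheroniConstant)) := by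
  have h1 := (Real.continuous_exp.tendsto _).comp tendsto_primeLogSum_sub_log_log
  have h2 := (tendsto_prod_one_sub_inv_sq.comp tendsto_nat_floor_atTop).mul h1
  refine h2.congr' ?_
  filter_upwards [eventually_gt_atTop 1] with x hx
  simp only [Function.comp_apply]
  rw [Real.exp_sub, Real.exp_log (Real.log_pos hx), exp_primeLogSum, ← mul_div_assoc,
    ← Finset.prod_mul_distrib, primeProd]
  congr 1
  refine Finset.prod_congr rfl fun p hp => ?_
  have hp' := (Nat.mem_primesLE.mp hp).2
  have hp1 : (1 : ℝ) < p := by exact_mod_cast hp'.one_lt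
  have : (p : ℝ) - 1 ≠ 0 := by linarith
  have : (1 - 1 / (p : ℝ)) ≠ 0 := by
    have : 1 / (p : ℝ) < 1 := by rw [div_lt_one (by linarith)]; exact hp1
    linarith
  field_simp
  ring

theorem dedekindPsi_eq_mul_prod {m : ℕ} (hm : m ≠ 0) :
    (dedekindPsi m : ℝ) = m * ∏ p ∈ m.primeFactors, (1 + 1 / (p : ℝ)) := by
  have h1 : (m : ℝ) = ∏ p ∈ m.primeFactors, (p : ℝ) ^ m.factorization p := by
    conv_lhs => rw [← Nat.prod_factorization_pow_eq_self hm]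
    rw [Finsupp.prod, Nat.support_factorization]
    push_cast
    rfl
  rw [dedekindPsi, Finsupp.prod, Nat.support_factorization]
  conv_rhs => rw [h1, ← Finset.prod_mul_distrib]
  push_cast
  refine Finset.prod_congr rfl fun p hp => ?_
  have hp' := Nat.prime_of_mem_primeFactors hp
  have hp0 : (p : ℝ) ≠ 0 := by exact_mod_cast hp'.ne_zero
  have ha : m.factorization p ≠ 0 := by
    rwa [← Finsupp.mem_support_iff, Nat.support_factorization]
  obtain ⟨a, ha'⟩ := Nat.exists_eq_succ_of_ne_zero ha
  rw [ha', Nat.succ_sub_one, pow_succ]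
  field_simp

theorem prod_primeFactors_le {m : ℕ} {y : ℝ} (hm : m ≠ 0) (hy : 1 < y) (hmy : Real.log m ≤ y) :
    ∏ p ∈ m.primeFactors, (1 + 1 / (p : ℝ)) ≤ primeProd y * Real.exp (1 / Real.log y) := by
  have hy0 : 0 < y := by linarith
  have hly := Real.log_pos hy
  have hone : ∀ p : ℕ, (1 : ℝ) ≤ 1 + 1 / (p : ℝ) := fun p => by
    have : (0 : ℝ) ≤ 1 / (p : ℝ) := by positivity
    linarith
  set S := m.primeFactors.filter fun p : ℕ => y < p with hS
  rw [← Finset.prod_filter_not_mul_prod_filter m.primeFactors fun p : ℕ => y < p]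
  apply mul_le_mul
  · apply Finset.prod_le_prod_of_subset_of_one_le
    · intro p hp
      rw [Finset.mem_filter, not_lt] at hp
      exact Nat.mem_primesLE.mpr
        ⟨Nat.le_floor hp.2, Nat.prime_of_mem_primeFactors hp.1⟩
    · intro p _; linarith [hone p]
    · intro p _ _; exact hone p
  · have h1 : ∏ p ∈ S, (1 + 1 / (p : ℝ)) ≤ ∏ p ∈ S, Real.exp (1 / y) := by
      apply Finset.prod_le_prod
      · intro p _; linarith [hone p]
      · intro p hp
        have hp' := (Finset.mem_filter.mp hp).2
        have h2 : 1 / (p : ℝ) ≤ 1 / y := one_div_le_one_div_of_le hy0 hp'.le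
        linarith [Real.add_one_le_exp (1 / y)]
    refine h1.trans ?_
    rw [Finset.prod_const, ← Real.exp_nat_mul, Real.exp_le_exp]
    have h3 : y ^ S.card ≤ (m : ℝ) := by
      calc y ^ S.card = ∏ p ∈ S, y := by rw [Finset.prod_const]
        _ ≤ ∏ p ∈ S, (p : ℝ) := Finset.prod_le_prod (fun _ _ => hy0.le)
            fun p hp => (Finset.mem_filter.mp hp).2.le
        _ = ((∏ p ∈ S, p : ℕ) : ℝ) := by push_cast; rfl
        _ ≤ m := by
            have h4 : ∏ p ∈ S, p ∣ m :=
              (Finset.prod_dvd_prod_of_subset _ _ _ (Finset.filter_subset _ _)).trans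
                (Nat.prod_primeFactors_dvd m)
            exact_mod_cast Nat.le_of_dvd (Nat.pos_of_ne_zero hm) h4
    have h5 := Real.log_le_log (by positivity) h3
    rw [Real.log_pow] at h5
    rw [mul_one_div, div_le_div_iff₀ hy0 hly]
    linarith
  · exact Finset.prod_nonneg fun p _ => by linarith [hone p]
  · exact Finset.prod_nonneg fun p _ => by linarith [hone p]

theorem dedekindPsi_totient_div_le {n : ℕ} (hn : 1 < Real.log n) :
    (dedekindPsi n.totient : ℝ) / (n * Real.log (Real.log n)) ≤
      primeProd (Real.log n) / Real.log (Real.log n) *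
        Real.exp (1 / Real.log (Real.log n)) := by
  have hn0 : 0 < n := by
    rcases Nat.eq_zero_or_pos n with rfl | h
    · simp at hn; linarith
    · exact h
  have hl := Real.log_pos hn
  have hn0' : (0 : ℝ) < n := by exact_mod_cast hn0
  have hm : n.totient ≠ 0 := (Nat.totient_pos.mpr hn0).ne'
  have hmn : (n.totient : ℝ) ≤ n := by exact_mod_cast Nat.totient_le n
  have h1 := prod_primeFactors_le hm hn
    (Real.log_le_log (by exact_mod_cast Nat.pos_of_ne_zero hm) hmn)
  have hP : 0 ≤ ∏ p ∈ n.totient.primeFactors, (1 + 1 / (p : ℝ)) :=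
    Finset.prod_nonneg fun p _ => by positivity
  rw [dedekindPsi_eq_mul_prod hm, div_mul_eq_mul_div, div_le_div_iff₀ (by positivity) hl]
  have h2 := mul_le_mul hmn h1 hP hn0'.le
  have h3 := mul_le_mul_of_nonneg_right h2 hl.le
  linarith

theorem tendsto_log_natCast_atTop : Tendsto (fun n : ℕ => Real.log n) atTop atTop :=
  Real.tendsto_log_atTop.comp tendsto_natCast_atTop_atTop

theorem tendsto_upper_bound :
    Tendsto (fun n : ℕ => primeProd (Real.log n) / Real.log (Real.log n) *
        Real.exp (1 / Real.log (Real.log n))) atTop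
      (𝓝 (6 / Real.pi ^ 2 * Real.exp Real.eulerMascheroniConstant)) := by
  have h1 := tendsto_primeProd_div_log.comp tendsto_log_natCast_atTop
  have h2 := tendsto_inv_atTop_zero.comp (Real.tendsto_log_atTop.comp tendsto_log_natCast_atTop)
  have h3 := h1.mul ((Real.continuous_exp.tendsto _).comp h2)
  simpa [Function.comp_def] using h3

/-- To evaluate the limsup it suffices to find infinitely many `n` with a nearly maximal ratio. -/
theorem limsup_eq_of_frequently
    (h : ∀ ε > 0, ∃ᶠ n : ℕ in atTop,
      6 / Real.pi ^ 2 * Real.exp Real.eulerMascheroniConstant - ε ≤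
        (dedekindPsi n.totient : ℝ) / (n * Real.log (Real.log n))) :
    limsup (fun n : ℕ => (dedekindPsi n.totient : ℝ) / (n * Real.log (Real.log n))) atTop =
      6 / Real.pi ^ 2 * Real.exp Real.eulerMascheroniConstant := by
  have hle : (fun n : ℕ => (dedekindPsi n.totient : ℝ) / (n * Real.log (Real.log n)))
      ≤ᶠ[atTop] fun n : ℕ => primeProd (Real.log n) / Real.log (Real.log n) *
        Real.exp (1 / Real.log (Real.log n)) := by
    filter_upwards [tendsto_log_natCast_atTop.eventually_gt_atTop 1] with n hn
    exact dedekindPsi_totient_div_le hn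
  have hbdd : IsBoundedUnder (· ≤ ·) atTop
      (fun n : ℕ => (dedekindPsi n.totient : ℝ) / (n * Real.log (Real.log n))) :=
    tendsto_upper_bound.isBoundedUnder_le.mono_le hle
  have hcobdd : IsCoboundedUnder (· ≤ ·) atTop
      (fun n : ℕ => (dedekindPsi n.totient : ℝ) / (n * Real.log (Real.log n))) :=
    IsCoboundedUnder.of_frequently_ge (h 1 one_pos)
  apply le_antisymm
  · rw [← tendsto_upper_bound.limsup_eq]
    exact limsup_le_limsup hle hcobdd tendsto_upper_bound.isBoundedUnder_le
  · apply le_of_forall_sub_le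
    intro ε hε
    exact le_limsup_of_frequently_le (h ε hε) hbdd

end

section

open MeasureTheory Topology Set

section

variable {N : ℕ}

theorem sum_norm_dirichletCharacter_le (χ : DirichletCharacter ℂ N) (n : ℕ) :
    ∑ k ∈ Finset.Icc 1 n, ‖χ k‖ ≤ n := by
  have := Finset.sum_le_card_nsmul (Finset.Icc 1 n) (fun k : ℕ => ‖χ k‖) 1
    fun k _ => χ.norm_le_one _
  simpa using this

theorem norm_sum_Icc_dirichletCharacter_le_self (χ : DirichletCharacter ℂ N) (n : ℕ) :
    ‖∑ k ∈ Finset.Icc 1 n, χ k‖ ≤ n := by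
  exact (norm_sum_le _ _).trans (sum_norm_dirichletCharacter_le χ n)

theorem sum_range_natCast_zmod [NeZero N] {R : Type*} [AddCommMonoid R] (f : ZMod N → R) :
    ∑ k ∈ Finset.range N, f k = ∑ a : ZMod N, f a := by
  apply Finset.sum_nbij (fun k : ℕ => (k : ZMod N))
  · intro _ _; exact Finset.mem_univ _
  · intro a ha b hb hab
    simp only [Finset.coe_range, Set.mem_Iio] at ha hb
    have := (ZMod.natCast_eq_natCast_iff' a b N).mp hab
    rwa [Nat.mod_eq_of_lt ha, Nat.mod_eq_of_lt hb] at this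
  · intro a _
    exact ⟨a.val, by simpa using ZMod.val_lt a, by simp⟩
  · intro _ _; rfl

theorem norm_sum_Icc_dirichletCharacter_le [NeZero N] {χ : DirichletCharacter ℂ N}
    (hχ : χ ≠ 1) (n : ℕ) :
    ‖∑ k ∈ Finset.Icc 1 n, χ k‖ ≤ N := by
  set g : ℕ → ℂ := fun n => ∑ k ∈ Finset.range n, χ ((k + 1 : ℕ) : ZMod N) with hg
  have hper : Function.Periodic g N := by
    intro m
    simp only [hg]
    rw [Finset.sum_range_add, add_eq_left]
    have h1 := sum_range_natCast_zmod (N := N) fun a => χ (((m + 1 : ℕ) : ZMod N) + a)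
    have h3 : ∑ a, χ (((m + 1 : ℕ) : ZMod N) + a) = ∑ a, χ a :=
      Equiv.sum_comp (Equiv.addLeft ((m + 1 : ℕ) : ZMod N)) χ
    rw [h3, MulChar.sum_eq_zero_of_ne_one hχ] at h1
    rw [← h1]
    refine Finset.sum_congr rfl fun k _ => ?_
    congr 1
    push_cast
    ring
  have h2 : ∑ k ∈ Finset.Icc 1 n, χ k = g n := by
    simp only [hg]
    clear hper
    induction n with
    | zero => simp
    | succ n ih => rw [Finset.sum_Icc_succ_top (by omega), ih, Finset.sum_range_succ]
  rw [h2, ← hper.map_mod_nat n]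
  refine (norm_sum_le _ _).trans ((Finset.sum_le_sum fun k _ => χ.norm_le_one _).trans ?_)
  simp only [Finset.sum_const, Finset.card_range, nsmul_eq_mul, mul_one]
  exact_mod_cast (Nat.mod_lt n (NeZero.pos N)).le

theorem norm_sum_Icc_dirichletCharacter_le_rpow [NeZero N] {χ : DirichletCharacter ℂ N}
    (hχ : χ ≠ 1) {b : ℝ}
    (hb : 0 < b) (hb' : b ≤ 1 / 2) {t : ℝ} (ht : 0 < t) :
    ‖∑ k ∈ Finset.Icc 1 ⌊t⌋₊, χ k‖ ≤ t ^ (1 - 2 * b) * (N : ℝ) ^ (2 * b) := by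
  set A := ‖∑ k ∈ Finset.Icc 1 ⌊t⌋₊, χ k‖
  have h1 : A ≤ t := (norm_sum_Icc_dirichletCharacter_le_self χ _).trans (Nat.floor_le ht.le)
  have h2 : A ≤ N := norm_sum_Icc_dirichletCharacter_le hχ _
  have hA : 0 ≤ A := norm_nonneg _
  rcases hA.eq_or_lt with h0 | h0
  · rw [← h0]; positivity
  · calc A = A ^ (1 - 2 * b) * A ^ (2 * b) := by
          rw [← Real.rpow_add h0]; simp
      _ ≤ _ := by
          apply mul_le_mul (Real.rpow_le_rpow hA h1 (by linarith))
            (Real.rpow_le_rpow hA h2 (by linarith)) (by positivity) (by positivity)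

/-- The summatory function of a Dirichlet character. -/
noncomputable def charSum (χ : DirichletCharacter ℂ N) (t : ℝ) : ℂ :=
  ∑ k ∈ Finset.Icc 1 ⌊t⌋₊, χ k

theorem measurable_charSum (χ : DirichletCharacter ℂ N) : Measurable (charSum χ) := by
  have : Measurable fun n : ℕ => ∑ k ∈ Finset.Icc 1 n, χ k := measurable_from_nat
  exact this.comp Nat.measurable_floor

theorem charSum_eq_zero (χ : DirichletCharacter ℂ N) {t : ℝ} (ht : t < 1) : charSum χ t = 0 := by
  rw [charSum, Nat.floor_eq_zero.mpr ht]
  simp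

theorem differentiableAt_mellin_charSum [NeZero N] {χ : DirichletCharacter ℂ N} (hχ : χ ≠ 1) {s : ℂ}
    (hs : s.re < 0) : DifferentiableAt ℂ (mellin (charSum χ)) s := by
  apply mellin_differentiableAt_of_isBigO_rpow (a := 0) (b := s.re - 1)
  · apply LocallyIntegrable.locallyIntegrableOn
    refine (locallyIntegrable_const (N : ℝ)).mono (measurable_charSum χ).aestronglyMeasurable ?_
    refine ae_of_all _ fun t => ?_
    rw [Real.norm_of_nonneg (by positivity)]
    exact norm_sum_Icc_dirichletCharacter_le hχ _
  · simp only [neg_zero, Real.rpow_zero]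
    refine Asymptotics.IsBigO.of_bound N (Eventually.of_forall fun t => ?_)
    rw [norm_one, mul_one]
    exact norm_sum_Icc_dirichletCharacter_le hχ ⌊t⌋₊
  · exact hs
  · apply (Asymptotics.isBigO_zero _ _).congr' _ EventuallyEq.rfl
    filter_upwards [Ioo_mem_nhdsGT (show (0 : ℝ) < 1 by norm_num)] with t ht
    exact (charSum_eq_zero χ ht.2).symm
  · linarith

theorem mellin_charSum_eq (χ : DirichletCharacter ℂ N) (s : ℂ) :
    mellin (charSum χ) (-s) = ∫ t in Ioi (1 : ℝ), charSum χ t * (t : ℂ) ^ (-(s + 1)) := by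
  conv_rhs => rw [← integral_Ici_eq_integral_Ioi]
  rw [mellin, setIntegral_eq_of_subset_of_forall_sdiff_eq_zero (s := Ici 1) (t := Ioi 0)
    measurableSet_Ioi (Ici_subset_Ioi.mpr zero_lt_one)]
  · refine setIntegral_congr_fun measurableSet_Ici fun t ht => ?_
    simp only [smul_eq_mul]
    rw [mul_comm]
    congr 2
    ring
  · intro t ht
    rw [charSum_eq_zero χ (not_le.mp ht.2), smul_zero]

theorem LFunction_eq_mul_mellin [NeZero N] {χ : DirichletCharacter ℂ N} (hχ : χ ≠ 1) {s : ℂ}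
    (hs : 0 < s.re) : χ.LFunction s = s * mellin (charSum χ) (-s) := by
  have hopen : IsOpen {s : ℂ | 0 < s.re} := isOpen_lt continuous_const Complex.continuous_re
  have hconn : IsPreconnected {s : ℂ | 0 < s.re} :=
    (convex_halfSpace_re_gt 0).isPreconnected
  have h1 : AnalyticOnNhd ℂ χ.LFunction {s : ℂ | 0 < s.re} :=
    (DirichletCharacter.differentiable_LFunction hχ).differentiableOn.analyticOnNhd hopen
  have h2 : AnalyticOnNhd ℂ (fun s => s * mellin (charSum χ) (-s)) {s : ℂ | 0 < s.re} := by
    apply DifferentiableOn.analyticOnNhd _ hopen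
    intro s hs
    have hs : 0 < s.re := hs
    have := differentiableAt_mellin_charSum hχ (show (-s).re < 0 by simpa using hs)
    exact (differentiableAt_id.mul (this.comp s differentiableAt_id.neg)).differentiableWithinAt
  refine h1.eqOn_of_preconnected_of_eventuallyEq h2 hconn (z₀ := 2) (by simp) ?_ hs
  have h3 : {s : ℂ | 1 < s.re} ∈ 𝓝 (2 : ℂ) :=
    (isOpen_lt continuous_const Complex.continuous_re).mem_nhds (by simp)
  filter_upwards [h3] with s hs
  have hs : 1 < s.re := hs
  rw [DirichletCharacter.LFunction_eq_LSeries χ hs, mellin_charSum_eq]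
  refine LSeries_eq_mul_integral' _ zero_le_one hs ?_
  refine Asymptotics.IsBigO.of_bound 1 (Eventually.of_forall fun n => ?_)
  rw [Real.norm_of_nonneg (Finset.sum_nonneg fun _ _ => norm_nonneg _), Real.rpow_one, one_mul,
    Real.norm_natCast]
  exact (sum_norm_dirichletCharacter_le χ n)

theorem norm_LFunction_le [NeZero N] {χ : DirichletCharacter ℂ N} (hχ : χ ≠ 1) {b : ℝ}
    (hb : 0 < b) (hb' : b ≤ 1 / 2) {s : ℂ} (hs : 1 - b ≤ s.re) :
    ‖χ.LFunction s‖ ≤ ‖s‖ * ((N : ℝ) ^ (2 * b) / b) := by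
  rw [LFunction_eq_mul_mellin hχ (by linarith), norm_mul, mellin_charSum_eq]
  refine mul_le_mul_of_nonneg_left ?_ (norm_nonneg _)
  have h1 : ∀ t ∈ Ioi (1 : ℝ), ‖charSum χ t * (t : ℂ) ^ (-(s + 1))‖ ≤
      (N : ℝ) ^ (2 * b) * t ^ (-1 - b) := by
    intro t ht
    have ht : 1 < t := ht
    have ht0 : 0 < t := by linarith
    rw [norm_mul, Complex.norm_cpow_eq_rpow_re_of_pos ht0]
    have h2 := norm_sum_Icc_dirichletCharacter_le_rpow hχ hb hb' ht0
    have h3 : t ^ (-(s + 1)).re ≤ t ^ (-(1 - b) - 1) := by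
      apply Real.rpow_le_rpow_of_exponent_le ht.le
      simp; linarith
    refine (mul_le_mul h2 h3 (by positivity) (by positivity)).trans (le_of_eq ?_)
    rw [mul_comm (t ^ (1 - 2 * b)), mul_assoc, ← Real.rpow_add ht0]
    congr 2
    ring
  have hR_int : IntegrableOn (fun t : ℝ => (N : ℝ) ^ (2 * b) * t ^ (-1 - b)) (Ioi 1) :=
    (integrableOn_Ioi_rpow_of_lt (by linarith) zero_lt_one).const_mul _
  refine (norm_integral_le_of_norm_le hR_int
    ((ae_restrict_mem measurableSet_Ioi).mono fun t ht => h1 t ht)).trans (le_of_eq ?_)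
  rw [integral_const_mul, integral_Ioi_rpow_of_lt (by linarith) zero_lt_one]
  have : -1 - b + 1 = -b := by ring
  rw [this, Real.one_rpow, neg_div_neg_eq, mul_one_div]

end

end

section

open Topology Set

section

variable {N : ℕ} [NeZero N]

theorem norm_deriv_LFunction_le {χ : DirichletCharacter ℂ N} (hχ : χ ≠ 1) {b : ℝ}
    (hb : 0 < b) (hb' : b ≤ 1 / 2) {s : ℂ} (hs : ‖s - 1‖ ≤ b / 2) :
    ‖deriv χ.LFunction s‖ ≤ 4 / b ^ 2 * (N : ℝ) ^ (2 * b) := by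
  have hdiff := DirichletCharacter.differentiable_LFunction hχ
  have key : ∀ z ∈ Metric.sphere s (b / 2), ‖χ.LFunction z‖ ≤ 2 * ((N : ℝ) ^ (2 * b) / b) := by
    intro z hz
    rw [mem_sphere_iff_norm] at hz
    have hz1 : ‖z - 1‖ ≤ b := by
      calc ‖z - 1‖ = ‖(z - s) + (s - 1)‖ := by ring_nf
        _ ≤ _ := norm_add_le _ _
        _ ≤ b := by linarith
    have hre : 1 - b ≤ z.re := by
      have := (Complex.abs_re_le_norm (z - 1)).trans hz1
      rw [abs_le] at this
      simp only [Complex.sub_re, Complex.one_re] at this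
      linarith [this.1]
    have hn : ‖z‖ ≤ 2 := by
      calc ‖z‖ = ‖(z - 1) + 1‖ := by ring_nf
        _ ≤ ‖z - 1‖ + ‖(1 : ℂ)‖ := norm_add_le _ _
        _ ≤ 2 := by rw [norm_one]; linarith
    refine (norm_LFunction_le hχ hb hb' hre).trans ?_
    gcongr
  refine (Complex.norm_deriv_le_of_forall_mem_sphere_norm_le (by positivity)
    hdiff.diffContOnCl key).trans (le_of_eq ?_)
  field_simp
  ring

theorem norm_LFunction_sub_LFunction_one_le {χ : DirichletCharacter ℂ N} (hχ : χ ≠ 1) {b : ℝ}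
    (hb : 0 < b) (hb' : b ≤ 1 / 2) {s : ℂ} (hs : ‖s - 1‖ ≤ b / 2) :
    ‖χ.LFunction s - χ.LFunction 1‖ ≤ 4 / b ^ 2 * (N : ℝ) ^ (2 * b) * ‖s - 1‖ := by
  refine (convex_closedBall (1 : ℂ) (b / 2)).norm_image_sub_le_of_norm_deriv_le
    (fun z _ => (DirichletCharacter.differentiable_LFunction hχ).differentiableAt)
    (fun z hz => norm_deriv_LFunction_le hχ hb hb' (mem_closedBall_iff_norm.1 hz)) ?_ ?_
  · exact Metric.mem_closedBall_self (by positivity)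
  · exact mem_closedBall_iff_norm.2 hs

end

theorem three_add_two_re_add_two_re_add_re_mul_nonneg {z w : ℂ} (hz : ‖z‖ ≤ 1) (hw : ‖w‖ ≤ 1) :
    0 ≤ 3 + 2 * z.re + 2 * w.re + (z * w).re := by
  have hz' : z.re ^ 2 + z.im ^ 2 ≤ 1 := by
    have := Complex.sq_norm z
    rw [Complex.normSq_apply] at this
    nlinarith [norm_nonneg z]
  have hw' : w.re ^ 2 + w.im ^ 2 ≤ 1 := by
    have := Complex.sq_norm w
    rw [Complex.normSq_apply] at this
    nlinarith [norm_nonneg w]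
  rw [Complex.mul_re]
  nlinarith [sq_nonneg (z.im - w.im), sq_nonneg (z.re + w.re + 2)]

open ArithmeticFunction in
theorem vonMangoldt_div_log_mem_Icc (n : ℕ) : vonMangoldt n / Real.log n ∈ Icc (0 : ℝ) 1 :=
  ⟨div_nonneg vonMangoldt_nonneg (Real.log_natCast_nonneg n),
    div_le_one_of_le₀ vonMangoldt_le_log (Real.log_natCast_nonneg n)⟩

open ArithmeticFunction in
theorem LSeriesSummable_mul_vonMangoldt_div_log {f : ℕ → ℂ} (hf : ∀ n, ‖f n‖ ≤ 1) {s : ℂ}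
    (hs : 1 < s.re) : LSeriesSummable (fun n : ℕ => f n * vonMangoldt n / Real.log n) s := by
  refine LSeriesSummable_of_bounded_of_one_lt_re (m := 1) (fun n _ => ?_) hs
  have h := vonMangoldt_div_log_mem_Icc n
  rw [mul_div_assoc, norm_mul, ← Complex.ofReal_div, Complex.norm_of_nonneg h.1]
  exact mul_le_one₀ (hf n) h.1 h.2

open ArithmeticFunction in
theorem one_le_mul_norm_LFunction {N₁ N₂ N : ℕ} [NeZero N₁] [NeZero N₂] [NeZero N]
    (χ₁ : DirichletCharacter ℂ N₁) (χ₂ : DirichletCharacter ℂ N₂) (χ : DirichletCharacter ℂ N)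
    (h : ∀ n : ℕ, χ n = χ₁ n * χ₂ n) {σ : ℝ} (hσ : 1 < σ) :
    1 ≤ ‖riemannZeta σ‖ ^ 3 * ‖χ₁.LFunction σ‖ ^ 2 * ‖χ₂.LFunction σ‖ ^ 2 * ‖χ.LFunction σ‖ := by
  have hs : 1 < (σ : ℂ).re := by simpa using hσ
  have e (M : ℕ) [NeZero M] (ψ : DirichletCharacter ℂ M) :
      ‖ψ.LFunction σ‖ = Real.exp (∑' n : ℕ, (ψ n).re *
        (vonMangoldt n / Real.log n * (n : ℝ) ^ (-σ))) := by
    rw [DirichletCharacter.LFunction_eq_LSeries ψ hs,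
      ← DirichletCharacter.LSeries_eq_exp_LSeries ψ hs, Complex.norm_exp, LSeries,
      Complex.re_tsum
        (LSeriesSummable_mul_vonMangoldt_div_log (fun n => ψ.norm_le_one _) hs)]
    congr 1
    refine tsum_congr fun n => ?_
    rcases eq_or_ne n 0 with rfl | hn
    · simp
    rw [LSeries.term_of_ne_zero hn, ← Complex.ofReal_natCast, ← Complex.ofReal_cpow n.cast_nonneg,
      mul_div_assoc, mul_div_assoc, ← Complex.ofReal_div, ← Complex.ofReal_div,
      Complex.re_mul_ofReal, Real.rpow_neg n.cast_nonneg]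
    rfl
  have summ (M : ℕ) (ψ : DirichletCharacter ℂ M) : Summable fun n : ℕ => (ψ n).re *
        (vonMangoldt n / Real.log n * (n : ℝ) ^ (-σ)) := by
    refine Summable.of_norm_bounded (g := fun n : ℕ => (n : ℝ) ^ (-σ)) (by simpa using hσ)
      fun n => ?_
    have h := vonMangoldt_div_log_mem_Icc n
    have hp : 0 ≤ (n : ℝ) ^ (-σ) := by positivity
    rw [norm_mul, norm_mul, Real.norm_of_nonneg h.1, Real.norm_of_nonneg hp, ← mul_assoc]
    refine mul_le_of_le_one_left hp (mul_le_one₀ ?_ h.1 h.2)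
    exact (Complex.abs_re_le_norm _).trans (ψ.norm_le_one _)
  have hζ := e 1 1
  rw [DirichletCharacter.LFunction_modOne_eq] at hζ
  rw [hζ, e N₁ χ₁, e N₂ χ₂, e N χ, ← Real.exp_nat_mul, ← Real.exp_nat_mul, ← Real.exp_nat_mul,
    ← Real.exp_add, ← Real.exp_add, ← Real.exp_add, Real.one_le_exp_iff, ← tsum_mul_left,
    ← tsum_mul_left, ← tsum_mul_left]
  have s0 := (summ 1 1).mul_left ((3 : ℕ) : ℝ)
  have s1 := (summ N₁ χ₁).mul_left ((2 : ℕ) : ℝ)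
  have s2 := (summ N₂ χ₂).mul_left ((2 : ℕ) : ℝ)
  rw [← s0.tsum_add s1, ← (s0.add s1).tsum_add s2, ← ((s0.add s1).add s2).tsum_add (summ N χ)]
  refine tsum_nonneg fun n => ?_
  have h1 : (1 : DirichletCharacter ℂ 1) n = 1 := MulChar.one_apply (isUnit_of_subsingleton _)
  have hw : 0 ≤ vonMangoldt n / Real.log n * (n : ℝ) ^ (-σ) :=
    mul_nonneg (vonMangoldt_div_log_mem_Icc n).1 (by positivity)
  have hp := three_add_two_re_add_two_re_add_re_mul_nonneg (χ₁.norm_le_one n) (χ₂.norm_le_one n)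
  rw [h1, h n]
  refine (mul_nonneg hp hw).trans (le_of_eq ?_)
  push_cast
  rw [Complex.one_re]
  ring

theorem changeLevel_mul_changeLevel_natCast {N₁ N₂ : ℕ} (χ₁ : DirichletCharacter ℂ N₁)
    (χ₂ : DirichletCharacter ℂ N₂) (n : ℕ) :
    (DirichletCharacter.changeLevel (dvd_mul_right N₁ N₂) χ₁ *
      DirichletCharacter.changeLevel (dvd_mul_left N₂ N₁) χ₂) (n : ZMod (N₁ * N₂)) =
      χ₁ n * χ₂ n := by
  by_cases h : n.Coprime (N₁ * N₂)
  · have hu := (ZMod.isUnit_iff_coprime n (N₁ * N₂)).2 h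
    obtain ⟨u, hu'⟩ := hu
    rw [MulChar.mul_apply, ← hu', DirichletCharacter.changeLevel_eq_cast_of_dvd,
      DirichletCharacter.changeLevel_eq_cast_of_dvd, hu', ZMod.cast_natCast (dvd_mul_right N₁ N₂),
      ZMod.cast_natCast (dvd_mul_left N₂ N₁)]
  · rw [MulChar.map_nonunit _ fun hu => h ((ZMod.isUnit_iff_coprime n (N₁ * N₂)).1 hu)]
    rw [Nat.coprime_mul_iff_right, not_and_or] at h
    rcases h with h | h
    · rw [χ₁.map_nonunit fun hu => h ((ZMod.isUnit_iff_coprime n _).1 hu), zero_mul]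
    · rw [χ₂.map_nonunit fun hu => h ((ZMod.isUnit_iff_coprime n _).1 hu), mul_zero]

theorem changeLevel_mul_changeLevel_ne_one {N₁ N₂ : ℕ} [NeZero N₁] (hN : N₁.Coprime N₂)
    {χ₁ : DirichletCharacter ℂ N₁} (hχ₁ : χ₁ ≠ 1) (χ₂ : DirichletCharacter ℂ N₂) :
    DirichletCharacter.changeLevel (dvd_mul_right N₁ N₂) χ₁ *
      DirichletCharacter.changeLevel (dvd_mul_left N₂ N₁) χ₂ ≠ 1 := by
  intro h
  refine hχ₁ (MulChar.ext fun u => ?_)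
  obtain ⟨k, hk₁, hk₂⟩ := Nat.chineseRemainder hN (u : ZMod N₁).val 1
  have h1 : (k : ZMod N₁) = u := by
    rw [(ZMod.natCast_eq_natCast_iff _ _ _).2 hk₁, ZMod.natCast_zmod_val]
  have h2 : (k : ZMod N₂) = 1 := by
    rw [(ZMod.natCast_eq_natCast_iff _ _ _).2 hk₂, Nat.cast_one]
  have hk : k.Coprime (N₁ * N₂) := by
    refine Nat.Coprime.mul_right ((ZMod.isUnit_iff_coprime _ _).1 ?_)
      ((ZMod.isUnit_iff_coprime _ _).1 ?_)
    · rw [h1]; exact u.isUnit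
    · rw [h2]; exact isUnit_one
  have := changeLevel_mul_changeLevel_natCast χ₁ χ₂ k
  rw [h, MulChar.one_apply ((ZMod.isUnit_iff_coprime _ _).2 hk), h1, h2, map_one, mul_one] at this
  rw [← this, MulChar.one_apply u.isUnit]

theorem eventually_norm_riemannZeta_le :
    ∀ᶠ t : ℝ in 𝓝[>] 0, ‖riemannZeta (1 + t : ℝ)‖ ≤ 2 / t := by
  have h : Tendsto (fun t : ℝ => ((1 + t : ℝ) : ℂ)) (𝓝[>] 0) (𝓝[≠] 1) := by
    refine tendsto_nhdsWithin_iff.2 ⟨?_, ?_⟩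
    · have : Continuous fun t : ℝ => ((1 + t : ℝ) : ℂ) := by fun_prop
      refine (this.tendsto' 0 1 (by simp)).mono_left nhdsWithin_le_nhds
    · filter_upwards [self_mem_nhdsWithin] with t ht
      have : t ≠ 0 := (ne_of_gt ht)
      simpa using this
  have h2 := (riemannZeta_residue_one.comp h).norm
  rw [norm_one] at h2
  filter_upwards [h2.eventually_le_const one_lt_two, self_mem_nhdsWithin] with t ht ht0
  have ht0 : 0 < t := ht0
  rw [le_div_iff₀ ht0]
  simp only [Function.comp_apply, norm_mul] at ht
  have e : ((1 + t : ℝ) : ℂ) - 1 = (t : ℂ) := by push_cast; ring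
  rw [e, Complex.norm_of_nonneg ht0.le] at ht
  linarith

theorem exists_forall_le_norm_LFunction_one_or {b : ℝ} (hb : 0 < b) (hb' : b ≤ 1 / 2) :
    ∃ z : ℝ, ∀ N₁ N₂ : ℕ, ∀ _ : NeZero N₁, ∀ _ : NeZero N₂, N₁.Coprime N₂ → z ≤ N₂ → N₁ ≤ N₂ →
      N₂ ≤ 2 * N₁ → ∀ χ₁ : DirichletCharacter ℂ N₁, ∀ χ₂ : DirichletCharacter ℂ N₂,
      χ₁ ≠ 1 → χ₂ ≠ 1 →
      (N₁ : ℝ) ^ (-(13 * b)) ≤ ‖χ₁.LFunction 1‖ ∨ (N₂ : ℝ) ^ (-(13 * b)) ≤ ‖χ₂.LFunction 1‖ := by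
  have ht : Tendsto (fun x : ℝ => x ^ (-(13 * b))) atTop (𝓝[>] 0) := by
    refine tendsto_nhdsWithin_iff.2 ⟨tendsto_rpow_neg_atTop (by positivity), ?_⟩
    filter_upwards [eventually_gt_atTop 0] with x hx
    exact rpow_pos_of_pos hx _
  set D := 4 / b ^ 2 with hD
  set A := (2 : ℝ) ^ (13 * b) with hA
  have hC : ∀ᶠ x : ℝ in atTop, 8 * (A + D) ^ 4 * (2 / b) * x ^ (-b) < 1 := by
    have := (tendsto_rpow_neg_atTop hb).const_mul (8 * (A + D) ^ 4 * (2 / b))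
    rw [mul_zero] at this
    exact this.eventually_lt_const one_pos
  have hsm : ∀ᶠ x : ℝ in atTop, x ^ (-(13 * b)) ≤ b / 2 :=
    (ht.mono_right nhdsWithin_le_nhds).eventually_le_const (by positivity)
  obtain ⟨z, hz⟩ := eventually_atTop.1
    (((hC.and hsm).and (ht.eventually eventually_norm_riemannZeta_le)).and (eventually_ge_atTop 1))
  refine ⟨z, fun N₁ N₂ _ _ hcop hzN h12 h21 χ₁ χ₂ hχ₁ hχ₂ => ?_⟩
  obtain ⟨⟨⟨hC, hsm⟩, hζ⟩, hQ1⟩ := hz (N₂ : ℝ) hzN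
  by_contra! hcon
  obtain ⟨hL₁, hL₂⟩ := hcon
  set Q : ℝ := (N₂ : ℝ) with hQ
  have hQ0 : 0 < Q := by linarith
  set t := Q ^ (-(13 * b)) with htdef
  have ht0 : 0 < t := rpow_pos_of_pos hQ0 _
  have hN1Q : (N₁ : ℝ) ≤ Q := by rw [hQ]; exact_mod_cast h12
  have hQN1 : Q ≤ 2 * N₁ := by rw [hQ]; exact_mod_cast h21
  have hN10 : (0 : ℝ) < N₁ := by linarith
  set χ := DirichletCharacter.changeLevel (dvd_mul_right N₁ N₂) χ₁ *
      DirichletCharacter.changeLevel (dvd_mul_left N₂ N₁) χ₂ with hχ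
  have hχ1 : χ ≠ 1 := changeLevel_mul_changeLevel_ne_one hcop hχ₁ χ₂
  have : NeZero (N₁ * N₂) := inferInstance
  have key := one_le_mul_norm_LFunction χ₁ χ₂ χ (changeLevel_mul_changeLevel_natCast χ₁ χ₂)
    (σ := 1 + t) (by linarith)
  have hst : ‖((1 + t : ℝ) : ℂ) - 1‖ = t := by
    have e : ((1 + t : ℝ) : ℂ) - 1 = (t : ℂ) := by push_cast; ring
    rw [e, Complex.norm_of_nonneg ht0.le]
  have hQb : 1 ≤ Q ^ (2 * b) := one_le_rpow hQ1 (by positivity)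
  have hD0 : 0 < D := by positivity
  have hA1 : 0 < A := by positivity
  have bd (M : ℕ) (_ : NeZero M) (ψ : DirichletCharacter ℂ M) (hψ : ψ ≠ 1) (hM : (M : ℝ) ≤ Q)
      (h1 : ‖ψ.LFunction 1‖ ≤ A * t) : ‖ψ.LFunction (1 + t : ℝ)‖ ≤ (A + D) * (Q ^ (2 * b) * t) := by
    have h2 := norm_LFunction_sub_LFunction_one_le hψ hb hb' (s := (1 + t : ℝ)) (by rwa [hst])
    rw [hst] at h2
    have h3 : (M : ℝ) ^ (2 * b) ≤ Q ^ (2 * b) := by gcongr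
    calc ‖ψ.LFunction (1 + t : ℝ)‖
        = ‖ψ.LFunction 1 + (ψ.LFunction (1 + t : ℝ) - ψ.LFunction 1)‖ := by ring_nf
      _ ≤ A * t + D * (M : ℝ) ^ (2 * b) * t := (norm_add_le _ _).trans (add_le_add h1 h2)
      _ ≤ A * (Q ^ (2 * b) * t) + D * Q ^ (2 * b) * t := by
          gcongr
          exact le_mul_of_one_le_left ht0.le hQb
      _ = _ := by ring
  have b1 := bd N₁ _ χ₁ hχ₁ hN1Q <| by
    refine hL₁.le.trans ?_
    rw [hA, htdef, rpow_neg hN10.le, rpow_neg hQ0.le]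
    rw [← div_eq_mul_inv, le_div_iff₀ (by positivity), inv_mul_le_iff₀ (by positivity),
      ← mul_rpow hN10.le zero_le_two]
    gcongr
    linarith
  have b2 := bd N₂ _ χ₂ hχ₂ le_rfl <| by
    refine hL₂.le.trans (le_mul_of_one_le_left ht0.le ?_)
    exact one_le_rpow one_le_two (by positivity)
  have b3 : ‖χ.LFunction (1 + t : ℝ)‖ ≤ 2 / b * Q ^ (4 * b) := by
    have h1 := norm_LFunction_le hχ1 hb hb' (s := (1 + t : ℝ)) (by
      rw [Complex.ofReal_re]; linarith)
    rw [Complex.norm_of_nonneg (by positivity)] at h1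
    refine h1.trans ?_
    have h2 : ((N₁ * N₂ : ℕ) : ℝ) ^ (2 * b) ≤ Q ^ (4 * b) := by
      have : Q ^ (4 * b) = (Q * Q) ^ (2 * b) := by
        rw [mul_rpow hQ0.le hQ0.le, ← rpow_add hQ0]; ring_nf
      rw [this]
      push_cast
      gcongr
    calc (1 + t) * (((N₁ * N₂ : ℕ) : ℝ) ^ (2 * b) / b) ≤ 2 * (Q ^ (4 * b) / b) := by
          gcongr
          linarith
      _ = _ := by ring
  have hfin : (2 / t) ^ 3 * ((A + D) * (Q ^ (2 * b) * t)) ^ 2 * ((A + D) * (Q ^ (2 * b) * t)) ^ 2 *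
      (2 / b * Q ^ (4 * b)) < 1 := by
    convert hC using 1
    have e : Q ^ (-b) = (Q ^ (2 * b)) ^ 4 * Q ^ (4 * b) * t := by
      rw [htdef, ← rpow_natCast, ← rpow_mul hQ0.le, ← rpow_add hQ0, ← rpow_add hQ0]
      congr 1
      push_cast
      ring
    rw [e]
    generalize Q ^ (2 * b) = P
    generalize Q ^ (4 * b) = R
    field_simp
    ring
  refine absurd (key.trans ?_) (not_le.2 hfin)
  gcongr

open ArithmeticFunction in
/-- The weight `Λ(n) (log n) ^ k n ^ (-σ)`. -/
noncomputable def vonMangoldtWeight (k : ℕ) (σ : ℝ) (n : ℕ) : ℝ :=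
  vonMangoldt n * Real.log n ^ k * (n : ℝ) ^ (-σ)

theorem vonMangoldtWeight_nonneg (k : ℕ) (σ : ℝ) (n : ℕ) : 0 ≤ vonMangoldtWeight k σ n :=
  mul_nonneg (mul_nonneg ArithmeticFunction.vonMangoldt_nonneg
    (pow_nonneg (Real.log_natCast_nonneg n) k)) (by positivity)

section

variable {N : ℕ}

open ArithmeticFunction in
theorem term_logMul_iterate_twist_vonMangoldt (χ : DirichletCharacter ℂ N) (k : ℕ) (σ : ℝ)
    (n : ℕ) :
    LSeries.term (LSeries.logMul^[k] ((fun n : ℕ => χ n) * fun n : ℕ => (vonMangoldt n : ℂ))) σ n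
      = χ n * vonMangoldtWeight k σ n := by
  have h : ∀ (f : ℕ → ℂ) (k : ℕ), LSeries.logMul^[k] f n = Complex.log n ^ k * f n := by
    intro f k
    induction k with
    | zero => simp
    | succ k ih => rw [Function.iterate_succ_apply', LSeries.logMul, ih]; ring
  rcases eq_or_ne n 0 with rfl | hn
  · simp [vonMangoldtWeight]
  rw [LSeries.term_of_ne_zero hn, h, vonMangoldtWeight, Real.rpow_neg n.cast_nonneg]
  push_cast
  rw [← Complex.ofReal_natCast, Complex.ofReal_cpow n.cast_nonneg,
    Pi.mul_apply]
  simp only [Complex.ofReal_natCast]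
  ring

open ArithmeticFunction in
theorem abscissaOfAbsConv_twist_vonMangoldt_lt (χ : DirichletCharacter ℂ N) {σ : ℝ}
    (hσ : 1 < σ) :
    LSeries.abscissaOfAbsConv ((fun n : ℕ => χ n) * fun n : ℕ => (vonMangoldt n : ℂ)) <
      (σ : ℂ).re := by
  have h1 : 1 < (1 + σ) / 2 := by linarith
  have h2 : (1 + σ) / 2 < σ := by linarith
  have := (DirichletCharacter.LSeriesSummable_twist_vonMangoldt χ
    (s := ((1 + σ) / 2 : ℝ)) (by simpa using h1)).abscissaOfAbsConv_le
  refine this.trans_lt ?_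
  rw [Complex.ofReal_re, Complex.ofReal_re]
  exact_mod_cast h2

theorem summable_dirichletCharacter_mul_vonMangoldtWeight (χ : DirichletCharacter ℂ N) (k : ℕ)
    {σ : ℝ} (hσ : 1 < σ) : Summable fun n : ℕ => χ n * vonMangoldtWeight k σ n := by
  simp_rw [← term_logMul_iterate_twist_vonMangoldt]
  refine LSeriesSummable_of_abscissaOfAbsConv_lt_re ?_
  rw [LSeries.absicssaOfAbsConv_logPowMul]
  exact abscissaOfAbsConv_twist_vonMangoldt_lt χ hσ

theorem summable_vonMangoldtWeight (k : ℕ) {σ : ℝ} (hσ : 1 < σ) :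
    Summable (vonMangoldtWeight k σ) := by
  have := summable_dirichletCharacter_mul_vonMangoldtWeight (1 : DirichletCharacter ℂ 1) k hσ
  refine Complex.summable_ofReal.1 (this.congr fun n => ?_)
  rw [MulChar.one_apply (isUnit_of_subsingleton _), one_mul]

open ArithmeticFunction in
theorem iteratedDeriv_neg_logDeriv_LFunction [NeZero N] (χ : DirichletCharacter ℂ N) (k : ℕ)
    {σ : ℝ} (hσ : 1 < σ) :
    iteratedDeriv k (fun s => -deriv χ.LFunction s / χ.LFunction s) σ =
      (-1) ^ k * ∑' n : ℕ, χ n * vonMangoldtWeight k σ n := by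
  have hs : 1 < (σ : ℂ).re := by simpa using hσ
  have h : (fun s => -deriv χ.LFunction s / χ.LFunction s) =ᶠ[𝓝 (σ : ℂ)]
      LSeries ((fun n : ℕ => χ n) * fun n : ℕ => (vonMangoldt n : ℂ)) := by
    filter_upwards [(isOpen_lt continuous_const Complex.continuous_re).mem_nhds hs] with s hs'
    have hs' : 1 < s.re := hs'
    rw [DirichletCharacter.LSeries_twist_vonMangoldt_eq χ hs',
      DirichletCharacter.LFunction_eq_LSeries χ hs',
      DirichletCharacter.deriv_LFunction_eq_deriv_LSeries χ hs']
  rw [h.iteratedDeriv_eq, LSeries_iteratedDeriv k (abscissaOfAbsConv_twist_vonMangoldt_lt χ hσ),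
    LSeries]
  simp_rw [term_logMul_iterate_twist_vonMangoldt]

theorem norm_tsum_dirichletCharacter_mul_vonMangoldtWeight_le [NeZero N]
    {χ : DirichletCharacter ℂ N} (hχ : χ ≠ 1) {b : ℝ} (hb : 0 < b) (hb' : b ≤ 1 / 2)
    (hL : (N : ℝ) ^ (-(13 * b)) ≤ ‖χ.LFunction 1‖) {η : ℝ}
    (hη : η = b ^ 2 / 32 * (N : ℝ) ^ (-(15 * b))) (k : ℕ) :
    ‖∑' n : ℕ, χ n * vonMangoldtWeight k (1 + η) n‖ ≤
      k.factorial / η ^ (k + 1) * (1 / (4 * 2 ^ k)) := by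
  have hN1 : (1 : ℝ) ≤ N := by exact_mod_cast Nat.one_le_iff_ne_zero.2 (NeZero.ne N)
  have hN0 : (0 : ℝ) < N := by linarith
  have hη0 : 0 < η := by rw [hη]; positivity
  have hηb : 4 * η ≤ b / 2 := by
    have : (N : ℝ) ^ (-(15 * b)) ≤ 1 := rpow_le_one_of_one_le_of_nonpos hN1 (by linarith)
    rw [hη]
    nlinarith [sq_nonneg b]
  have hdiff := DirichletCharacter.differentiable_LFunction hχ
  set P := (N : ℝ) ^ (-(13 * b)) with hP
  have hP0 : 0 < P := by positivity
  have hηP : 4 / b ^ 2 * (N : ℝ) ^ (2 * b) * (4 * η) = P / 2 := by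
    have : (N : ℝ) ^ (-(15 * b)) = P / (N : ℝ) ^ (2 * b) := by
      rw [hP, ← rpow_sub hN0]; ring_nf
    rw [hη, this]
    field_simp
    norm_num
  have low : ∀ s : ℂ, ‖s - 1‖ ≤ 4 * η → P / 2 ≤ ‖χ.LFunction s‖ := by
    intro s hs
    have h1 := norm_LFunction_sub_LFunction_one_le hχ hb hb' (hs.trans hηb)
    have h2 : 4 / b ^ 2 * (N : ℝ) ^ (2 * b) * ‖s - 1‖ ≤ P / 2 := by
      rw [← hηP]; gcongr
    have h3 : ‖χ.LFunction 1‖ ≤ ‖χ.LFunction s‖ + ‖χ.LFunction s - χ.LFunction 1‖ := by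
      rw [norm_sub_rev]
      calc ‖χ.LFunction 1‖ = ‖χ.LFunction s + (χ.LFunction 1 - χ.LFunction s)‖ := by ring_nf
        _ ≤ _ := norm_add_le _ _
    linarith
  have quot : ∀ s : ℂ, ‖s - 1‖ ≤ 4 * η →
      ‖-deriv χ.LFunction s / χ.LFunction s‖ ≤ 1 / (4 * η) := by
    intro s hs
    have h1 := low s hs
    have h2 := norm_deriv_LFunction_le hχ hb hb' (hs.trans hηb)
    rw [norm_div, norm_neg, div_le_div_iff₀ (by linarith) (by positivity), one_mul]
    calc ‖deriv χ.LFunction s‖ * (4 * η) ≤ 4 / b ^ 2 * (N : ℝ) ^ (2 * b) * (4 * η) := by gcongr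
      _ = P / 2 := hηP
      _ ≤ _ := h1
  have hball : ∀ s ∈ Metric.closedBall ((1 + η : ℝ) : ℂ) (2 * η), ‖s - 1‖ ≤ 4 * η := by
    intro s hs
    rw [mem_closedBall_iff_norm] at hs
    calc ‖s - 1‖ = ‖(s - (1 + η : ℝ)) + (η : ℂ)‖ := by push_cast; ring_nf
      _ ≤ ‖s - (1 + η : ℝ)‖ + ‖(η : ℂ)‖ := norm_add_le _ _
      _ ≤ 4 * η := by rw [Complex.norm_of_nonneg hη0.le]; linarith
  have hd : DiffContOnCl ℂ (fun s => -deriv χ.LFunction s / χ.LFunction s)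
      (Metric.ball ((1 + η : ℝ) : ℂ) (2 * η)) := by
    refine DifferentiableOn.diffContOnCl fun s hs => ?_
    have hs' := hball s (Metric.closure_ball_subset_closedBall hs)
    have hne : χ.LFunction s ≠ 0 := norm_pos_iff.1 (by linarith [low s hs'])
    refine (DifferentiableAt.div ?_ hdiff.differentiableAt hne).differentiableWithinAt
    exact (hdiff.contDiff.differentiable_deriv_two).neg.differentiableAt
  have key := Complex.norm_iteratedDeriv_le_of_forall_mem_sphere_norm_le k (by positivity) hd
    fun z hz => quot z (hball z (Metric.sphere_subset_closedBall hz))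
  rw [iteratedDeriv_neg_logDeriv_LFunction χ k (by linarith), norm_mul, norm_pow, norm_neg,
    norm_one, one_pow, one_mul] at key
  refine key.trans (le_of_eq ?_)
  rw [mul_pow, pow_succ]
  field_simp

end

theorem iteratedDeriv_inv_sub_one (k : ℕ) (η : ℝ) :
    iteratedDeriv k (fun s : ℂ => (s - 1)⁻¹) (1 + η : ℝ) =
      (-1) ^ k * (k.factorial / η ^ (k + 1) : ℝ) := by
  have := congrFun (iter_deriv_inv_linear_sub (𝕜 := ℂ) k 1 1) (1 + η : ℝ)
  rw [iteratedDeriv_eq_iterate]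
  simp only [one_mul, one_pow, mul_one] at this
  rw [this]
  push_cast
  rw [add_sub_cancel_left, show (-1 - k : ℤ) = -((k + 1 : ℕ) : ℤ) by push_cast; ring, zpow_neg,
    zpow_natCast]
  ring

theorem exists_closedBall_LFunctionTrivChar₁_ne_zero : ∃ ρ : ℝ, 0 < ρ ∧
    ∀ s ∈ Metric.closedBall (1 : ℂ) ρ, DirichletCharacter.LFunctionTrivChar₁ 1 s ≠ 0 := by
  have h : ∀ᶠ s in 𝓝 (1 : ℂ), DirichletCharacter.LFunctionTrivChar₁ 1 s ≠ 0 :=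
    (DirichletCharacter.differentiable_LFunctionTrivChar₁ 1).continuous.continuousAt.eventually_ne
      (DirichletCharacter.LFunctionTrivChar₁_apply_one_ne_zero 1)
  exact Metric.nhds_basis_closedBall.eventually_iff.1 h

theorem neg_logDeriv_LFunctionTrivChar_one_eq {s : ℂ} (hs : s ≠ 1)
    (h : DirichletCharacter.LFunctionTrivChar₁ 1 s ≠ 0) :
    -deriv (DirichletCharacter.LFunctionTrivChar 1) s / DirichletCharacter.LFunctionTrivChar 1 s =
      (s - 1)⁻¹ + -deriv (DirichletCharacter.LFunctionTrivChar₁ 1) s /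
        DirichletCharacter.LFunctionTrivChar₁ 1 s := by
  have hs' : s - 1 ≠ 0 := sub_ne_zero.2 hs
  rw [DirichletCharacter.LFunctionTrivChar₁, Function.update_of_ne hs] at h
  rw [DirichletCharacter.deriv_LFunctionTrivChar₁_apply_of_ne_one _ hs,
    DirichletCharacter.LFunctionTrivChar₁, Function.update_of_ne hs]
  have h' := right_ne_zero_of_mul h
  field_simp
  ring

theorem exists_forall_tsum_vonMangoldtWeight_mem_Icc : ∃ δ : ℝ, 0 < δ ∧ ∀ η, 0 < η → η ≤ δ →
    ∀ k : ℕ, ∑' n, vonMangoldtWeight k (1 + η) n ∈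
      Icc (k.factorial / η ^ (k + 1) / 2) (2 * (k.factorial / η ^ (k + 1))) := by
  obtain ⟨ρ, hρ, hne⟩ := exists_closedBall_LFunctionTrivChar₁_ne_zero
  have hdiff := DirichletCharacter.differentiable_LFunctionTrivChar₁ 1
  set f := DirichletCharacter.LFunctionTrivChar₁ 1 with hf
  have hd' := hdiff.contDiff.differentiable_deriv_two
  have hcont : ContinuousOn (fun s => -deriv f s / f s) (Metric.closedBall 1 ρ) :=
    (hd'.continuous.neg.continuousOn).div hdiff.continuous.continuousOn hne
  obtain ⟨C, hC⟩ := (isCompact_closedBall (1 : ℂ) ρ).exists_bound_of_continuousOn hcont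
  set C₁ := max C 1 with hC₁
  have hC₁0 : 0 < C₁ := lt_max_of_lt_right one_pos
  refine ⟨min (ρ / 2) (1 / (2 * C₁)), by positivity, fun η hη hηδ k => ?_⟩
  have hη1 : η ≤ ρ / 2 := hηδ.trans (min_le_left _ _)
  have hη2 : η ≤ 1 / (2 * C₁) := hηδ.trans (min_le_right _ _)
  have hball : Metric.closedBall ((1 + η : ℝ) : ℂ) (ρ / 2) ⊆ Metric.closedBall 1 ρ := by
    refine Metric.closedBall_subset_closedBall' ?_
    have : dist ((1 + η : ℝ) : ℂ) 1 = η := by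
      rw [dist_eq_norm, show ((1 + η : ℝ) : ℂ) - 1 = (η : ℂ) by push_cast; ring,
        Complex.norm_of_nonneg hη.le]
    linarith
  have hdo : DifferentiableOn ℂ (fun s => -deriv f s / f s)
      (Metric.closedBall ((1 + η : ℝ) : ℂ) (ρ / 2)) := fun s hs =>
    (hd'.neg.differentiableAt.div hdiff.differentiableAt
      (hne s (hball hs))).differentiableWithinAt
  have hdc : DiffContOnCl ℂ (fun s => -deriv f s / f s)
      (Metric.ball ((1 + η : ℝ) : ℂ) (ρ / 2)) :=
    (hdo.mono Metric.closure_ball_subset_closedBall).diffContOnCl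
  have hg := Complex.norm_iteratedDeriv_le_of_forall_mem_sphere_norm_le k (by positivity) hdc
    (C := C₁) fun z hz =>
      (hC z (hball (Metric.sphere_subset_closedBall hz))).trans (le_max_left _ _)
  have hne1 : ((1 + η : ℝ) : ℂ) ≠ 1 := by
    intro h
    have : (1 + η : ℝ) = 1 := by exact_mod_cast h
    linarith
  have hmem : Metric.closedBall ((1 + η : ℝ) : ℂ) (ρ / 2) ∈ 𝓝 ((1 + η : ℝ) : ℂ) :=
    Metric.closedBall_mem_nhds _ (by positivity)
  have hEq : (fun s => -deriv (DirichletCharacter.LFunctionTrivChar 1) s /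
      DirichletCharacter.LFunctionTrivChar 1 s) =ᶠ[𝓝 ((1 + η : ℝ) : ℂ)]
      fun s => (s - 1)⁻¹ + -deriv f s / f s := by
    filter_upwards [hmem, isOpen_ne.mem_nhds hne1] with s hs hs1
    exact neg_logDeriv_LFunctionTrivChar_one_eq hs1 (hne s (hball hs))
  have key := iteratedDeriv_neg_logDeriv_LFunction (1 : DirichletCharacter ℂ 1) k
    (σ := 1 + η) (by linarith)
  have hW : ∑' n : ℕ, (1 : DirichletCharacter ℂ 1) n * vonMangoldtWeight k (1 + η) n =
      ((∑' n : ℕ, vonMangoldtWeight k (1 + η) n : ℝ) : ℂ) := by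
    rw [Complex.ofReal_tsum]
    refine tsum_congr fun n => ?_
    rw [MulChar.one_apply (isUnit_of_subsingleton _), one_mul]
  have hc1 : ContDiffAt ℂ k (fun s : ℂ => (s - 1)⁻¹) ((1 + η : ℝ) : ℂ) :=
    ContDiffAt.inv (by fun_prop) (sub_ne_zero.2 hne1)
  have hc2 : ContDiffAt ℂ k (fun s => -deriv f s / f s) ((1 + η : ℝ) : ℂ) :=
    (hdo.analyticAt hmem).contDiffAt
  rw [hW, hEq.iteratedDeriv_eq, iteratedDeriv_fun_add hc1 hc2, iteratedDeriv_inv_sub_one] at key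
  set W := ∑' n : ℕ, vonMangoldtWeight k (1 + η) n
  set M : ℝ := k.factorial / η ^ (k + 1) with hM
  have hM0 : 0 < M := by positivity
  have hbound : |W - M| ≤ M / 2 := by
    have e : iteratedDeriv k (fun s => -deriv f s / f s) ((1 + η : ℝ) : ℂ) =
        (-1) ^ k * ((W - M : ℝ) : ℂ) := by
      push_cast at key ⊢
      linear_combination key
    rw [e, norm_mul, norm_pow, norm_neg, norm_one, one_pow, one_mul, Complex.norm_real,
      Real.norm_eq_abs] at hg
    refine hg.trans ?_
    have h1 : C₁ * η ≤ 1 / 2 := by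
      rw [le_div_iff₀ (by positivity)] at hη2
      linarith
    rw [hM, div_div, div_le_div_iff₀ (by positivity) (by positivity)]
    have h2 : η ^ k ≤ (ρ / 2) ^ k := pow_le_pow_left₀ hη.le hη1 k
    calc (k.factorial : ℝ) * C₁ * (η ^ (k + 1) * 2) = k.factorial * (C₁ * η * 2) * η ^ k := by ring
      _ ≤ k.factorial * 1 * (ρ / 2) ^ k := by
          gcongr
          linarith
      _ = _ := by ring
  rw [abs_le] at hbound
  constructor <;> linarith [hbound.1, hbound.2]

theorem tsum_indicator_coprime_sub_le {N : ℕ} [NeZero N] {w : ℕ → ℝ} (hw : Summable w) {K : ℝ}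
    (hw0 : ∀ n, 0 ≤ w n) (hK0 : 0 ≤ K)
    (hK : ∀ χ : DirichletCharacter ℂ N, χ ≠ 1 → ‖∑' n : ℕ, χ n * (w n : ℂ)‖ ≤ K) :
    ∑' n, {n : ℕ | n.Coprime N}.indicator w n - N.totient * K ≤
      N.totient * ∑' n, {n : ℕ | (n : ZMod N) = 1}.indicator w n := by
  have hs (χ : DirichletCharacter ℂ N) : Summable fun n : ℕ => χ n * (w n : ℂ) := by
    refine Summable.of_norm_bounded hw fun n => ?_
    rw [norm_mul, Complex.norm_of_nonneg (hw0 n)]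
    exact mul_le_of_le_one_left (hw0 n) (χ.norm_le_one _)
  have h1 : ((N.totient * ∑' n, {n : ℕ | (n : ZMod N) = 1}.indicator w n : ℝ) : ℂ) =
      ∑ χ : DirichletCharacter ℂ N, ∑' n : ℕ, χ n * (w n : ℂ) := by
    rw [← Summable.tsum_finsetSum fun χ _ => hs χ, ← tsum_mul_left, Complex.ofReal_tsum]
    refine tsum_congr fun n => ?_
    rw [← Finset.sum_mul, DirichletCharacter.sum_characters_eq]
    by_cases h : (n : ZMod N) = 1
    · rw [indicator_of_mem (by exact h), if_pos h]
      push_cast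
      rfl
    · rw [indicator_of_notMem (by exact h), if_neg h]
      simp
  have h2 : ∑' n : ℕ, (1 : DirichletCharacter ℂ N) n * (w n : ℂ) =
      ((∑' n, {n : ℕ | n.Coprime N}.indicator w n : ℝ) : ℂ) := by
    rw [Complex.ofReal_tsum]
    refine tsum_congr fun n => ?_
    by_cases h : n.Coprime N
    · rw [indicator_of_mem (by exact h), MulChar.one_apply ((ZMod.isUnit_iff_coprime _ _).2 h),
        one_mul]
    · rw [indicator_of_notMem (by exact h),
        MulChar.map_nonunit _ fun hu => h ((ZMod.isUnit_iff_coprime _ _).1 hu)]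
      simp
  rw [← Finset.add_sum_erase _ _ (Finset.mem_univ (1 : DirichletCharacter ℂ N)), h2] at h1
  have h3 : ‖∑ χ ∈ Finset.univ.erase (1 : DirichletCharacter ℂ N), ∑' n : ℕ, χ n * (w n : ℂ)‖ ≤
      N.totient * K := by
    refine (norm_sum_le_of_le _ fun χ hχ => hK χ (Finset.ne_of_mem_erase hχ)).trans ?_
    rw [Finset.sum_const, nsmul_eq_mul]
    gcongr
    refine (Finset.card_le_univ _).trans (le_of_eq ?_)
    rw [← Nat.card_eq_fintype_card, DirichletCharacter.card_eq_totient_of_hasEnoughRootsOfUnity]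
  rw [← sub_eq_iff_eq_add'.2 h1, ← Complex.ofReal_sub, Complex.norm_real, Real.norm_eq_abs,
    abs_le] at h3
  linarith [h3.1]

theorem log_pow_le_factorial_mul_rpow (k : ℕ) {c : ℝ} (hc : 0 < c) {n : ℕ} (hn : n ≠ 0) :
    Real.log n ^ k ≤ k.factorial * (n : ℝ) ^ c / c ^ k := by
  have hn0 : (0 : ℝ) < n := by positivity
  have h := Real.pow_div_factorial_le_exp (c * Real.log n)
    (mul_nonneg hc.le (Real.log_natCast_nonneg n)) k
  rw [mul_comm c, ← Real.rpow_def_of_pos hn0, div_le_iff₀ (by positivity), mul_pow] at h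
  rw [le_div_iff₀ (by positivity)]
  linarith

open ArithmeticFunction in
theorem summable_indicator_not_prime_vonMangoldt :
    Summable fun n : ℕ =>
      {n : ℕ | ¬ n.Prime}.indicator (fun n => (vonMangoldt n : ℝ)) n *
        (n : ℝ) ^ (-(3 / 4) : ℝ) := by
  set f : ℕ → ℝ := {n : ℕ | ¬ n.Prime}.indicator (fun n => (vonMangoldt n : ℝ)) with hf
  have hf0 : ∀ n, 0 ≤ f n := indicator_nonneg fun _ _ => vonMangoldt_nonneg
  have hO : (fun n : ℕ => ∑ k ∈ Finset.Icc 1 n, f k) =O[atTop]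
      fun n : ℕ => (n : ℝ) ^ (1 / 2 : ℝ) := by
    have := Chebyshev.isBigO_psi_sub_theta_sqrt.comp_tendsto tendsto_natCast_atTop_atTop
    refine this.congr (fun n => ?_) fun n => ?_
    · simp only [Function.comp_apply, Pi.sub_apply]
      rw [Chebyshev.psi_sub_theta_eq_sum_not_prime, Nat.floor_natCast, Finset.sum_filter]
      exact Finset.sum_congr rfl fun k _ => by simp [hf, indicator_apply]
    · simp [Real.sqrt_eq_rpow]
  have := LSeriesSummable_of_sum_norm_bigO_and_nonneg (s := ((3 / 4 : ℝ) : ℂ)) hO hf0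
    (by norm_num) (by rw [Complex.ofReal_re]; norm_num)
  refine Complex.summable_ofReal.1 (this.congr fun n => ?_)
  rcases eq_or_ne n 0 with rfl | hn
  · simp
  rw [LSeries.term_of_ne_zero hn, ← Complex.ofReal_natCast, ← Complex.ofReal_cpow n.cast_nonneg,
    Real.rpow_neg n.cast_nonneg, ← Complex.ofReal_div, div_eq_mul_inv]

open ArithmeticFunction in
theorem exists_forall_tsum_indicator_vonMangoldtWeight_le : ∃ C : ℝ, 0 ≤ C ∧
    ∀ (m k : ℕ) (η : ℝ), 0 < η →
      ∑' n, {n : ℕ | n ≤ m ∨ ¬ n.Prime}.indicator (vonMangoldtWeight k (1 + η)) n ≤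
        k.factorial * ((m : ℝ) ^ 2 + C * 4 ^ k) := by
  set g : ℕ → ℝ := fun n =>
      {n : ℕ | ¬ n.Prime}.indicator (fun n => (vonMangoldt n : ℝ)) n * (n : ℝ) ^ (-(3 / 4) : ℝ)
    with hg
  have hg0 : ∀ n, 0 ≤ g n := fun n =>
    mul_nonneg (indicator_nonneg (fun _ _ => vonMangoldt_nonneg) n) (by positivity)
  refine ⟨∑' n, g n, tsum_nonneg hg0, fun m k η hη => ?_⟩
  set u : ℕ → ℝ := fun n => if n ∈ Finset.Icc 1 m then (m : ℝ) else 0 with hu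
  have hu0 : ∀ n, 0 ≤ u n := fun n => by simp only [hu]; split_ifs <;> positivity
  have hus : HasSum u ((m : ℝ) ^ 2) := by
    have : HasSum u (∑ n ∈ Finset.Icc 1 m, u n) :=
      hasSum_sum_of_ne_finset_zero fun n hn => by simp only [hu, if_neg hn]
    convert this using 1
    rw [Finset.sum_congr rfl fun n hn => (if_pos hn : u n = m)]
    rw [Finset.sum_const, Nat.card_Icc, nsmul_eq_mul]
    simp [pow_two]
  have hsum := ((hus.add (summable_indicator_not_prime_vonMangoldt.hasSum.mul_right
    ((4 : ℝ) ^ k)))).mul_left (k.factorial : ℝ)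
  rw [← hsum.tsum_eq]
  refine ((summable_vonMangoldtWeight k (by linarith)).indicator _).tsum_le_tsum (fun n => ?_)
    hsum.summable
  have hgn : 0 ≤ g n * 4 ^ k := mul_nonneg (hg0 n) (by positivity)
  change _ ≤ (k.factorial : ℝ) * (u n + g n * 4 ^ k)
  by_cases hn : n ∈ {n : ℕ | n ≤ m ∨ ¬ n.Prime}
  swap
  · rw [indicator_of_notMem hn]
    exact mul_nonneg (by positivity) (add_nonneg (hu0 n) hgn)
  rw [indicator_of_mem hn, vonMangoldtWeight]
  rcases eq_or_ne n 0 with rfl | hn0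
  · simp only [ArithmeticFunction.map_zero, zero_mul]
    exact mul_nonneg (by positivity) (add_nonneg (hu0 0) hgn)
  have hn1 : (1 : ℝ) ≤ n := by exact_mod_cast Nat.one_le_iff_ne_zero.2 hn0
  have hn0' : (0 : ℝ) < n := by linarith
  have hΛ : (0 : ℝ) ≤ vonMangoldt n := vonMangoldt_nonneg
  have hη' : (n : ℝ) ^ (-(1 + η)) ≤ (n : ℝ) ^ (-1 : ℝ) :=
    rpow_le_rpow_of_exponent_le hn1 (by linarith)
  by_cases hm : n ≤ m
  · have h1 := log_pow_le_factorial_mul_rpow k one_pos hn0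
    rw [rpow_one, one_pow, div_one] at h1
    have h2 : (vonMangoldt n : ℝ) ≤ m := by
      refine vonMangoldt_le_log.trans ((Real.log_le_self hn0'.le).trans ?_)
      exact_mod_cast hm
    have h3 : u n = m := if_pos (Finset.mem_Icc.2 ⟨Nat.one_le_iff_ne_zero.2 hn0, hm⟩)
    calc (vonMangoldt n : ℝ) * Real.log n ^ k * (n : ℝ) ^ (-(1 + η))
        ≤ m * (k.factorial * n) * (n : ℝ) ^ (-1 : ℝ) := by gcongr
      _ = k.factorial * m := by rw [rpow_neg_one]; field_simp
      _ ≤ _ := by rw [h3]; gcongr; linarith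
  · have hp : ¬ n.Prime := hn.resolve_left hm
    have h1 := log_pow_le_factorial_mul_rpow k (c := 1 / 4) (by norm_num) hn0
    have h3 : g n = vonMangoldt n * (n : ℝ) ^ (-(3 / 4) : ℝ) := by
      simp only [hg]; rw [indicator_of_mem (by exact hp)]
    calc (vonMangoldt n : ℝ) * Real.log n ^ k * (n : ℝ) ^ (-(1 + η))
        ≤ vonMangoldt n * (k.factorial * (n : ℝ) ^ (1 / 4 : ℝ) / (1 / 4) ^ k) *
            (n : ℝ) ^ (-1 : ℝ) := by gcongr
      _ = k.factorial * (vonMangoldt n * ((n : ℝ) ^ (1 / 4 : ℝ) * (n : ℝ) ^ (-1 : ℝ)) * 4 ^ k) := by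
          rw [one_div_pow, div_div_eq_mul_div, div_one]; ring
      _ = k.factorial * (g n * 4 ^ k) := by
          rw [h3, ← rpow_add hn0']; norm_num
      _ ≤ _ := by gcongr; linarith [hu0 n]

theorem tsum_indicator_lt_vonMangoldtWeight_le (k : ℕ) {η Y : ℝ} (hη : 0 < η) (hY : 0 < Y) :
    ∑' n, {n : ℕ | Y < n}.indicator (vonMangoldtWeight k (1 + η)) n ≤
      Y ^ (-(η / 2)) * ∑' n, vonMangoldtWeight k (1 + η / 2) n := by
  rw [← tsum_mul_left]
  refine ((summable_vonMangoldtWeight k (by linarith)).indicator _).tsum_le_tsum (fun n => ?_)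
    ((summable_vonMangoldtWeight k (by linarith)).mul_left _)
  by_cases hn : n ∈ {n : ℕ | Y < n}
  · have hn' : Y < n := hn
    have hn0 : (0 : ℝ) < n := hY.trans hn'
    rw [indicator_of_mem hn, vonMangoldtWeight, vonMangoldtWeight,
      show -(1 + η) = -(η / 2) + -(1 + η / 2) by ring, rpow_add hn0, mul_left_comm]
    have : (n : ℝ) ^ (-(η / 2)) ≤ Y ^ (-(η / 2)) :=
      rpow_le_rpow_of_nonpos hY hn'.le (by linarith)
    have h0 := vonMangoldtWeight_nonneg k (1 + η / 2) n
    rw [vonMangoldtWeight] at h0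
    gcongr
  · rw [indicator_of_notMem hn]
    exact mul_nonneg (by positivity) (vonMangoldtWeight_nonneg _ _ _)

theorem tsum_vonMangoldtWeight_le_of_forall_prime {q : ℕ} [NeZero q] (hq : q.Prime) {k : ℕ}
    {σ Y K : ℝ} (hσ : 1 < σ) (hK0 : 0 ≤ K)
    (hK : ∀ χ : DirichletCharacter ℂ q, χ ≠ 1 → ‖∑' n : ℕ, χ n * vonMangoldtWeight k σ n‖ ≤ K)
    (hp : ∀ p : ℕ, p.Prime → (p : ZMod q) = 1 → q ^ 2 < p → Y < p) :
    ∑' n, vonMangoldtWeight k σ n ≤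
      (q + 1) * ∑' n, {n : ℕ | n ≤ q ^ 2 ∨ ¬ n.Prime}.indicator (vonMangoldtWeight k σ) n +
      q * ∑' n, {n : ℕ | Y < n}.indicator (vonMangoldtWeight k σ) n + q * K := by
  have hw := summable_vonMangoldtWeight k hσ
  have hw0 := vonMangoldtWeight_nonneg k σ
  set w := vonMangoldtWeight k σ
  have h1 := tsum_indicator_coprime_sub_le (N := q) hw hw0 hK0 hK
  set E := ∑' n, {n : ℕ | n ≤ q ^ 2 ∨ ¬ n.Prime}.indicator w n with hE
  set T := ∑' n, {n : ℕ | Y < n}.indicator w n with hT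
  have hE0 : 0 ≤ E := tsum_nonneg (indicator_nonneg fun n _ => hw0 n)
  have hT0 : 0 ≤ T := tsum_nonneg (indicator_nonneg fun n _ => hw0 n)
  have h2 : ∑' n, {n : ℕ | (n : ZMod q) = 1}.indicator w n ≤ E + T := by
    rw [hE, hT, ← (hw.indicator _).tsum_add (hw.indicator _)]
    refine (hw.indicator _).tsum_le_tsum (fun n => ?_) ((hw.indicator _).add (hw.indicator _))
    refine indicator_le' (fun n hn => ?_) (fun n _ => add_nonneg
      (indicator_nonneg (fun n _ => hw0 n) n) (indicator_nonneg (fun n _ => hw0 n) n)) n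
    by_cases hS : n ∈ {n : ℕ | n ≤ q ^ 2 ∨ ¬ n.Prime}
    · rw [indicator_of_mem hS]
      exact le_add_of_nonneg_right (indicator_nonneg (fun n _ => hw0 n) n)
    · have hS' : ¬ (n ≤ q ^ 2 ∨ ¬ n.Prime) := hS
      push Not at hS'
      have : n ∈ {n : ℕ | Y < n} := hp n hS'.2 hn hS'.1
      rw [indicator_of_mem this]
      exact le_add_of_nonneg_left (indicator_nonneg (fun n _ => hw0 n) n)
  have h3 : ∑' n, w n ≤ ∑' n, {n : ℕ | n.Coprime q}.indicator w n + E := by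
    rw [hE, ← (hw.indicator _).tsum_add (hw.indicator _)]
    refine hw.tsum_le_tsum (fun n => ?_) ((hw.indicator _).add (hw.indicator _))
    by_cases hS : n ∈ {n : ℕ | n.Coprime q}
    · rw [indicator_of_mem hS]
      exact le_add_of_nonneg_right (indicator_nonneg (fun n _ => hw0 n) n)
    · have : n ∈ {n : ℕ | n ≤ q ^ 2 ∨ ¬ n.Prime} := by
        by_cases hn : n.Prime
        · left
          have : n = q := by
            by_contra hne
            exact hS ((Nat.coprime_primes hn hq).2 hne)
          rw [this]
          nlinarith [hq.pos]
        · right; exact hn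
      rw [indicator_of_mem this]
      exact le_add_of_nonneg_left (indicator_nonneg (fun n _ => hw0 n) n)
  have h4 : (q.totient : ℝ) ≤ q := by exact_mod_cast Nat.totient_le q
  have h5 : (q.totient : ℝ) * ∑' n, {n : ℕ | (n : ZMod q) = 1}.indicator w n ≤ q * (E + T) := by
    gcongr
    exact tsum_nonneg (indicator_nonneg fun n _ => hw0 n)
  have h6 : (q.totient : ℝ) * K ≤ q * K := by gcongr
  linarith

theorem two_pow_natCeil_four_mul_log_bounds {x : ℝ} (hx : 1 ≤ x) :
    x ^ 2 ≤ 2 ^ ⌈4 * Real.log x⌉₊ ∧ (2 : ℝ) ^ ⌈4 * Real.log x⌉₊ ≤ 2 * x ^ 4 := by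
  have hx0 : 0 < x := by linarith
  have hl := Real.log_nonneg hx
  have h1 := Nat.le_ceil (4 * Real.log x)
  have h2 := (Nat.ceil_lt_add_one (by positivity : 0 ≤ 4 * Real.log x)).le
  set k := ⌈4 * Real.log x⌉₊
  have e : (2 : ℝ) ^ k = Real.exp (Real.log 2 * k) := by
    rw [Real.exp_mul, Real.exp_log two_pos, rpow_natCast]
  have hlog2 := Real.log_two_gt_d9
  have hlog2' := Real.log_two_lt_d9
  constructor
  · rw [e]
    calc x ^ 2 = Real.exp (2 * Real.log x) := by
          rw [show (2 : ℝ) = ((2 : ℕ) : ℝ) by norm_num, Real.exp_nat_mul, Real.exp_log hx0]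
      _ ≤ _ := by
          rw [Real.exp_le_exp]
          nlinarith
  · calc (2 : ℝ) ^ k ≤ Real.exp (Real.log 2 + 4 * Real.log x) := by
          rw [e, Real.exp_le_exp]
          nlinarith
      _ = 2 * x ^ 4 := by
          rw [Real.exp_add, Real.exp_log two_pos, show (4 : ℝ) = ((4 : ℕ) : ℝ) by norm_num,
            Real.exp_nat_mul, Real.exp_log hx0]

theorem exists_forall_exists_prime_of_le_norm_LFunction {b : ℝ} (hb : 0 < b) (hb' : b ≤ 1 / 16) :
    ∃ z : ℝ, ∀ q : ℕ, ∀ _ : NeZero q, q.Prime → z ≤ q →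
      (∀ χ : DirichletCharacter ℂ q, χ ≠ 1 → (q : ℝ) ^ (-(13 * b)) ≤ ‖χ.LFunction 1‖) →
      ∃ p : ℕ, p.Prime ∧ (p : ZMod q) = 1 ∧ q ^ 2 < p ∧
        (p : ℝ) ≤ Real.exp ((q : ℝ) ^ (16 * b)) := by
  obtain ⟨δ, hδ, hmain⟩ := exists_forall_tsum_vonMangoldtWeight_mem_Icc
  obtain ⟨C, hC0, hC⟩ := exists_forall_tsum_indicator_vonMangoldtWeight_le
  have e1 : ∀ᶠ x : ℝ in atTop, b ^ 2 / 32 * x ^ (-(15 * b)) ≤ δ := by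
    have := (tendsto_rpow_neg_atTop (by positivity : 0 < 15 * b)).const_mul (b ^ 2 / 32)
    rw [mul_zero] at this
    exact this.eventually_le_const hδ
  have e2 : ∀ᶠ x : ℝ in atTop, 2 * (1 + C) * x⁻¹ ≤ 1 / 16 := by
    have := tendsto_inv_atTop_zero.const_mul (2 * (1 + C))
    rw [mul_zero] at this
    exact this.eventually_le_const (by norm_num)
  have e3 : ∀ᶠ x : ℝ in atTop, 8 * x ^ 5 * Real.exp (-(b ^ 2 / 64) * x ^ b) ≤ 1 / 16 := by
    have h := (tendsto_rpow_mul_exp_neg_mul_atTop_nhds_zero (5 / b) (b ^ 2 / 64)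
      (by positivity)).comp (tendsto_rpow_atTop hb)
    have := h.const_mul 8
    rw [mul_zero] at this
    filter_upwards [this.eventually_le_const (by norm_num : (0 : ℝ) < 1 / 16),
      eventually_gt_atTop 0] with x hx hx0
    refine le_trans (le_of_eq ?_) hx
    simp only [Function.comp_apply]
    rw [← rpow_mul hx0.le, mul_div_cancel₀ _ hb.ne', ← mul_assoc]
    norm_cast
  obtain ⟨z, hz⟩ := eventually_atTop.1 ((e1.and e2).and (e3.and (eventually_ge_atTop 8)))
  refine ⟨z, fun q _ hq hzq hχ => ?_⟩
  obtain ⟨⟨e1, e2⟩, e3, hx8⟩ := hz (q : ℝ) hzq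
  by_contra! hcon
  have hχ' := fun χ hχ1 => norm_tsum_dirichletCharacter_mul_vonMangoldtWeight_le hχ1 hb
    (by linarith) (hχ χ hχ1) rfl ⌈4 * Real.log q⌉₊
  set k := ⌈4 * Real.log q⌉₊ with hk
  set η := b ^ 2 / 32 * (q : ℝ) ^ (-(15 * b)) with hη
  set x : ℝ := (q : ℝ) with hx
  have hx1 : 1 ≤ x := by linarith
  have hx0 : 0 < x := by linarith
  have hη0 : 0 < η := by positivity
  set M : ℝ := k.factorial / η ^ (k + 1) with hM
  have hM0 : 0 < M := by positivity
  have key := tsum_vonMangoldtWeight_le_of_forall_prime hq (by linarith) (by positivity) hχ' hcon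
  have b1 := (hmain η hη0 e1 k).1
  have b2 := (hmain (η / 2) (by positivity) (by linarith) k).2
  have b3 := hC (q ^ 2) k η hη0
  have b4 := tsum_indicator_lt_vonMangoldtWeight_le k hη0 (Real.exp_pos (x ^ (16 * b)))
  obtain ⟨t1, t2⟩ := two_pow_natCeil_four_mul_log_bounds hx1
  rw [← hk] at t1 t2
  set t : ℝ := 2 ^ k with ht
  have ht0 : 0 < t := by positivity
  have hE : (x + 1) * (k.factorial * (((q ^ 2 : ℕ) : ℝ) ^ 2 + C * 4 ^ k)) ≤ M * (1 / 16) := by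
    have h4 : (4 : ℝ) ^ k = t ^ 2 := by rw [ht, ← pow_mul, mul_comm, pow_mul]; norm_num
    have hη64 : η ^ (k + 1) ≤ (t ^ 6)⁻¹ := by
      have h1 : η ≤ (2 ^ 6)⁻¹ := by
        have : x ^ (-(15 * b)) ≤ 1 := rpow_le_one_of_one_le_of_nonpos hx1 (by linarith)
        rw [hη]
        nlinarith
      calc η ^ (k + 1) ≤ η ^ k := pow_le_pow_of_le_one hη0.le (h1.trans (by norm_num)) (by simp)
        _ ≤ ((2 ^ 6)⁻¹) ^ k := by gcongr
        _ = (t ^ 6)⁻¹ := by rw [inv_pow, ht, ← pow_mul, ← pow_mul, mul_comm]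
    have hq4 : ((q ^ 2 : ℕ) : ℝ) ^ 2 ≤ t ^ 2 := by push_cast; gcongr
    have h5 : (x + 1) * (((q ^ 2 : ℕ) : ℝ) ^ 2 + C * 4 ^ k) ≤ 2 * (1 + C) * x⁻¹ * t ^ 6 := by
      rw [h4]
      calc (x + 1) * (((q ^ 2 : ℕ) : ℝ) ^ 2 + C * t ^ 2) ≤ (2 * x) * (t ^ 2 + C * t ^ 2) := by
            gcongr; linarith
        _ = 2 * (1 + C) * x⁻¹ * ((x ^ 2) * t ^ 2) := by field_simp
        _ ≤ 2 * (1 + C) * x⁻¹ * (t ^ 4 * t ^ 2) := by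
            gcongr
            have : 1 ≤ t := by nlinarith
            calc x ^ 2 ≤ t := t1
              _ ≤ t ^ 4 := le_self_pow₀ this (by norm_num)
        _ = _ := by ring
    have h6 : (k.factorial : ℝ) = M * η ^ (k + 1) := by rw [hM]; field_simp
    calc (x + 1) * (k.factorial * (((q ^ 2 : ℕ) : ℝ) ^ 2 + C * 4 ^ k))
        = k.factorial * ((x + 1) * (((q ^ 2 : ℕ) : ℝ) ^ 2 + C * 4 ^ k)) := by ring
      _ ≤ k.factorial * (2 * (1 + C) * x⁻¹ * t ^ 6) := by gcongr
      _ ≤ k.factorial * (1 / 16 * t ^ 6) := by gcongr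
      _ ≤ M * (t ^ 6)⁻¹ * (1 / 16 * t ^ 6) := by rw [h6]; gcongr
      _ = _ := by field_simp
  have hT : x * (Real.exp (x ^ (16 * b)) ^ (-(η / 2)) *
      (2 * (k.factorial / (η / 2) ^ (k + 1)))) ≤ M * (1 / 8) := by
    have h1 : Real.exp (x ^ (16 * b)) ^ (-(η / 2)) = Real.exp (-(b ^ 2 / 64) * x ^ b) := by
      rw [← Real.exp_mul]
      congr 1
      have : x ^ b = x ^ (16 * b) * x ^ (-(15 * b)) := by rw [← rpow_add hx0]; ring_nf
      rw [hη, this]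
      ring
    have h2 : 2 * (k.factorial / (η / 2) ^ (k + 1)) = M * (4 * t) := by
      rw [hM, div_pow, ht, pow_succ 2 k]
      field_simp
      norm_num
    rw [h1, h2]
    calc x * (Real.exp (-(b ^ 2 / 64) * x ^ b) * (M * (4 * t)))
        ≤ x * (Real.exp (-(b ^ 2 / 64) * x ^ b) * (M * (4 * (2 * x ^ 4)))) := by gcongr
      _ = M * (8 * x ^ 5 * Real.exp (-(b ^ 2 / 64) * x ^ b)) := by ring
      _ ≤ M * (1 / 8) := by gcongr; linarith
  have hKb : x * (M * (1 / (4 * t))) ≤ M * (1 / 16) := by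
    have : x * (1 / (4 * t)) ≤ 1 / 16 := by
      rw [mul_one_div, div_le_div_iff₀ (by positivity) (by norm_num)]
      nlinarith
    calc x * (M * (1 / (4 * t))) = M * (x * (1 / (4 * t))) := by ring
      _ ≤ _ := by gcongr
  have c1 := (mul_le_mul_of_nonneg_left b3 (by positivity : 0 ≤ x + 1)).trans hE
  have c2 := (mul_le_mul_of_nonneg_left (b4.trans (mul_le_mul_of_nonneg_left b2
    (by positivity))) hx0.le).trans hT
  linarith

end

/-- The moduli `q` carrying a nonprincipal Dirichlet character `χ` with
`‖L(1, χ)‖ < q ^ (-13 b)`. -/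
def exceptionalModuli (b : ℝ) : Set ℕ :=
  {q | ∃ (_ : NeZero q) (χ : DirichletCharacter ℂ q),
    χ ≠ 1 ∧ ‖χ.LFunction 1‖ < (q : ℝ) ^ (-(13 * b))}

theorem exists_forall_two_mul_lt_of_mem_exceptionalModuli {b : ℝ} (hb : 0 < b)
    (hb' : b ≤ 1 / 2) : ∃ z : ℕ, ∀ q₁ ∈ exceptionalModuli b, ∀ q₂ ∈ exceptionalModuli b,
      q₁.Prime → q₂.Prime → z ≤ q₁ → q₁ < q₂ → 2 * q₁ < q₂ := by
  obtain ⟨z, hz⟩ := exists_forall_le_norm_LFunction_one_or hb hb'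
  refine ⟨⌈z⌉₊, ?_⟩
  rintro q₁ ⟨i₁, χ₁, hχ₁, h₁⟩ q₂ ⟨i₂, χ₂, hχ₂, h₂⟩ hp₁ hp₂ hzq hlt
  by_contra! hle
  have hz2 : z ≤ q₂ := (Nat.le_ceil z).trans (by exact_mod_cast hzq.trans hlt.le)
  rcases hz q₁ q₂ i₁ i₂ ((Nat.coprime_primes hp₁ hp₂).2 hlt.ne) hz2 hlt.le hle χ₁ χ₂ hχ₁ hχ₂
    with h | h
  · exact absurd h (not_le.2 h₁)
  · exact absurd h (not_le.2 h₂)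

theorem exists_forall_exists_prime_of_notMem_exceptionalModuli {b : ℝ} (hb : 0 < b)
    (hb' : b ≤ 1 / 16) : ∃ z : ℕ, ∀ q : ℕ, q.Prime → z ≤ q → q ∉ exceptionalModuli b →
      ∃ p : ℕ, p.Prime ∧ (p : ZMod q) = 1 ∧ q ^ 2 < p ∧
        (p : ℝ) ≤ Real.exp ((q : ℝ) ^ (16 * b)) := by
  obtain ⟨z, hz⟩ := exists_forall_exists_prime_of_le_norm_LFunction hb hb'
  refine ⟨⌈z⌉₊, fun q hq hzq hqB => ?_⟩
  have : NeZero q := ⟨hq.ne_zero⟩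
  refine hz q this hq ((Nat.le_ceil z).trans (by exact_mod_cast hzq)) fun χ hχ => ?_
  by_contra! h
  exact hqB ⟨this, χ, hχ, h⟩

theorem sum_one_div_le_of_two_mul_lt (s : Finset ℕ) :
    ∀ m : ℕ, 0 < m → (∀ a ∈ s, m ≤ a) → (∀ a ∈ s, ∀ b ∈ s, a < b → 2 * a < b) →
      ∑ a ∈ s, 1 / (a : ℝ) ≤ 2 / m := by
  induction s using Finset.induction_on_min with
  | empty => intro m _ _ _; rw [Finset.sum_empty]; positivity
  | insert a s ha ih =>
    intro m hm hms hs
    have hma : m ≤ a := hms a (Finset.mem_insert_self a s)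
    have ha0 : (0 : ℝ) < a := by exact_mod_cast hm.trans_le hma
    rw [Finset.sum_insert fun h => (ha a h).false]
    have h1 := ih (2 * a) (by omega)
      (fun b hb => (hs a (Finset.mem_insert_self a s) b (Finset.mem_insert_of_mem hb) (ha b hb)).le)
      (fun b hb c hc => hs b (Finset.mem_insert_of_mem hb) c (Finset.mem_insert_of_mem hc))
    have h2 : (2 : ℝ) / a ≤ 2 / m := by gcongr
    push_cast at h1
    have h3 : (2 : ℝ) / (2 * a) = 1 / a := by field_simp
    have h4 : (2 : ℝ) / a = 1 / a + 1 / a := by ring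
    linarith

theorem one_sub_sum_le_prod_one_sub_of_le_one {ι : Type*} (s : Finset ι) (f : ι → ℝ)
    (h0 : ∀ i ∈ s, 0 ≤ f i) (h1 : ∀ i ∈ s, f i ≤ 1) :
    1 - ∑ i ∈ s, f i ≤ ∏ i ∈ s, (1 - f i) := by
  classical
  induction s using Finset.induction_on with
  | empty => simp
  | insert a s ha ih =>
    rw [Finset.sum_insert ha, Finset.prod_insert ha]
    have h := ih (fun i hi => h0 i (Finset.mem_insert_of_mem hi))
      (fun i hi => h1 i (Finset.mem_insert_of_mem hi))
    have ha0 := h0 a (Finset.mem_insert_self a s)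
    have ha1 := h1 a (Finset.mem_insert_self a s)
    have hs : 0 ≤ ∑ i ∈ s, f i :=
      Finset.sum_nonneg fun i hi => h0 i (Finset.mem_insert_of_mem hi)
    nlinarith [mul_le_mul_of_nonneg_left h (sub_nonneg.2 ha1), mul_nonneg ha0 hs]

theorem sum_one_div_sq_le_of_forall_lt {s : Finset ℕ} {z : ℕ} (hz : 0 < z)
    (hs : ∀ a ∈ s, z < a) : ∑ a ∈ s, 1 / (a : ℝ) ^ 2 ≤ 1 / (z : ℝ) := by
  have hsub : s ⊆ Finset.Ioc z (max z (s.sup id)) := fun a ha =>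
    Finset.mem_Ioc.2 ⟨hs a ha, le_max_of_le_right (Finset.le_sup (f := id) ha)⟩
  have h := sum_Ioc_inv_sq_le_sub (α := ℝ) hz.ne' (le_max_left z (s.sup id))
  simp only [one_div]
  refine (Finset.sum_le_sum_of_subset_of_nonneg hsub fun _ _ _ => by positivity).trans
    (h.trans ?_)
  simp

theorem mul_prod_one_add_le_dedekindPsi_totient_prod (s : Finset ℕ) (f : ℕ → ℕ)
    (hs : ∀ q ∈ s, q.Prime) (hf : ∀ q ∈ s, (f q).Prime) (hfq : ∀ q ∈ s, (f q : ZMod q) = 1) :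
    (1 - ∑ q ∈ s, 1 / (f q : ℝ)) * ∏ q ∈ s, (1 + 1 / (q : ℝ)) ≤
      (dedekindPsi (Nat.totient (∏ p ∈ s.image f, p)) : ℝ) / (∏ p ∈ s.image f, p : ℕ) := by
  classical
  have himage : ∀ p ∈ s.image f, p.Prime := by
    intro p hp
    obtain ⟨q, hq, rfl⟩ := Finset.mem_image.1 hp
    exact hf q hq
  set n := ∏ p ∈ s.image f, p with hn
  have hn0 : n ≠ 0 := Finset.prod_ne_zero_iff.2 fun p hp => (himage p hp).ne_zero
  have hφ0 : n.totient ≠ 0 := (Nat.totient_pos.2 (Nat.pos_of_ne_zero hn0)).ne'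
  have htot : (n.totient : ℝ) = n * ∏ p ∈ s.image f, (1 - 1 / (p : ℝ)) := by
    have h := Nat.totient_eq_mul_prod_factors n
    rw [Nat.primeFactors_prod himage] at h
    have h' := congrArg (fun r : ℚ => (r : ℝ)) h
    push_cast at h'
    simpa only [one_div] using h'
  have hnR : (0 : ℝ) < n := by exact_mod_cast Nat.pos_of_ne_zero hn0
  have hphi : 1 - ∑ q ∈ s, 1 / (f q : ℝ) ≤ (n.totient : ℝ) / n := by
    rw [htot, mul_div_cancel_left₀ _ hnR.ne']
    have h1 := one_sub_sum_le_prod_one_sub_of_le_one (s.image f) (fun p => 1 / (p : ℝ))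
      (fun p _ => by positivity)
      (fun p hp => by
        have : (1 : ℝ) ≤ p := by exact_mod_cast (himage p hp).one_le
        exact (div_le_one (by linarith)).2 this)
    have h2 : ∑ p ∈ s.image f, 1 / (p : ℝ) ≤ ∑ q ∈ s, 1 / (f q : ℝ) :=
      Finset.sum_image_le_of_nonneg fun p _ => by positivity
    linarith
  have hsub : s ⊆ n.totient.primeFactors := by
    intro q hq
    refine Nat.mem_primeFactors.2 ⟨hs q hq, ?_, hφ0⟩
    have h1 : q ∣ f q - 1 :=
      (Nat.modEq_iff_dvd' (hf q hq).one_le).1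
        ((ZMod.natCast_eq_natCast_iff _ _ _).1 (by simpa using (hfq q hq).symm))
    rw [← Nat.totient_prime (hf q hq)] at h1
    exact h1.trans (Nat.totient_dvd_of_dvd
      (Finset.dvd_prod_of_mem (fun p => p) (Finset.mem_image_of_mem f hq)))
  rw [dedekindPsi_eq_mul_prod hφ0, mul_div_right_comm]
  refine mul_le_mul hphi ?_ (Finset.prod_nonneg fun _ _ => by positivity) (by positivity)
  exact Finset.prod_le_prod_of_subset_of_one_le hsub (fun _ _ => by positivity)
    fun p _ _ => by simp

theorem mul_one_sub_sum_le_prod_filter (s : Finset ℕ) (g : ℕ → Prop) [DecidablePred g]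
    (hs : ∀ q ∈ s, q ≠ 0) :
    (∏ q ∈ s, (1 + 1 / (q : ℝ))) * (1 - ∑ q ∈ s with ¬ g q, 1 / (q : ℝ)) ≤
      ∏ q ∈ s with g q, (1 + 1 / (q : ℝ)) := by
  have hle : ∀ q ∈ s.filter (fun q => ¬ g q), 1 / (q : ℝ) ≤ 1 := fun q hq => by
    have : (1 : ℝ) ≤ q := by
      exact_mod_cast Nat.one_le_iff_ne_zero.2 (hs q (Finset.mem_filter.1 hq).1)
    exact (div_le_one (by linarith)).2 this
  have h1 := one_sub_sum_le_prod_one_sub_of_le_one (s.filter fun q => ¬ g q)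
    (fun q => 1 / (q : ℝ)) (fun _ _ => by positivity) hle
  have h2 : (∏ q ∈ s with ¬ g q, (1 + 1 / (q : ℝ))) *
      ∏ q ∈ s with ¬ g q, (1 - 1 / (q : ℝ)) ≤ 1 := by
    rw [← Finset.prod_mul_distrib]
    refine Finset.prod_le_one (fun q hq => ?_) fun q hq => ?_
    · exact mul_nonneg (by positivity) (sub_nonneg.2 (hle q hq))
    · nlinarith [sq_nonneg (1 / (q : ℝ))]
  have h3 : 0 ≤ ∏ q ∈ s with g q, (1 + 1 / (q : ℝ)) :=
    Finset.prod_nonneg fun _ _ => by positivity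
  calc _ ≤ (∏ q ∈ s, (1 + 1 / (q : ℝ))) * ∏ q ∈ s with ¬ g q, (1 - 1 / (q : ℝ)) :=
        mul_le_mul_of_nonneg_left h1 (Finset.prod_nonneg fun _ _ => by positivity)
    _ = (∏ q ∈ s with g q, (1 + 1 / (q : ℝ))) * ((∏ q ∈ s with ¬ g q, (1 + 1 / (q : ℝ))) *
        ∏ q ∈ s with ¬ g q, (1 - 1 / (q : ℝ))) := by
        rw [← mul_assoc, Finset.prod_filter_mul_prod_filter_not]
    _ ≤ _ := mul_le_of_le_one_right h3 h2

theorem log_prod_image_le (s : Finset ℕ) (f : ℕ → ℕ) (hf : ∀ q ∈ s, f q ≠ 0) :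
    Real.log (∏ p ∈ s.image f, p : ℕ) ≤ ∑ q ∈ s, Real.log (f q) := by
  classical
  push_cast
  rw [Real.log_prod fun p hp => ?_]
  · exact Finset.sum_image_le_of_nonneg fun p _ => Real.log_natCast_nonneg p
  · obtain ⟨q, hq, rfl⟩ := Finset.mem_image.1 hp
    exact_mod_cast hf q hq

theorem exists_natCast_le_dedekindPsi_totient_div {b : ℝ} (hb : 0 < b) (hb' : b ≤ 1 / 16) :
    ∃ Z : ℕ, ∀ z : ℕ, Z ≤ z → 2 ≤ z → ∃ (n : ℝ → ℕ) (K : ℝ), ∀ x : ℝ, 0 ≤ x →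
      (1 - 2 / (z : ℝ)) ^ 2 * primeProd x ≤ (dedekindPsi (Nat.totient (n x)) : ℝ) / n x ∧
      Real.log (n x) ≤ K + x * x ^ (16 * b) := by
  classical
  obtain ⟨z₁, hz₁⟩ := exists_forall_two_mul_lt_of_mem_exceptionalModuli hb (by linarith)
  obtain ⟨z₂, hz₂⟩ := exists_forall_exists_prime_of_notMem_exceptionalModuli hb hb'
  refine ⟨max z₁ z₂, fun z hz hz0 => ?_⟩
  have hzR : (2 : ℝ) ≤ z := by exact_mod_cast hz0
  set g : ℕ → Prop := fun q => q ≤ z ∨ q ∉ exceptionalModuli b with hg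
  have key : ∀ q : ℕ, ∃ p : ℕ, q.Prime → g q → p.Prime ∧ (p : ZMod q) = 1 ∧ q ^ 2 < p ∧
      z ^ 2 < p ∧ (z < q → (p : ℝ) ≤ Real.exp ((q : ℝ) ^ (16 * b))) := by
    intro q
    by_cases hq : q.Prime
    swap
    · exact ⟨0, fun h => absurd h hq⟩
    have : NeZero q := ⟨hq.ne_zero⟩
    rcases le_or_gt q z with hqz | hqz
    · obtain ⟨p, hpz, hp, hpq⟩ := Nat.forall_exists_prime_gt_and_eq_mod
        (isUnit_one : IsUnit (1 : ZMod q)) (z ^ 2)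
      exact ⟨p, fun _ _ => ⟨hp, hpq, (Nat.pow_le_pow_left hqz 2).trans_lt hpz, hpz,
        fun h => absurd h (not_lt.2 hqz)⟩⟩
    · by_cases hqB : q ∈ exceptionalModuli b
      · exact ⟨0, fun _ h => (h.elim (fun h => absurd h (not_le.2 hqz)) fun h => absurd hqB h)⟩
      · obtain ⟨p, hp, hpq, hqp, hpe⟩ := hz₂ q hq ((le_max_right _ _).trans (hz.trans hqz.le)) hqB
        exact ⟨p, fun _ _ => ⟨hp, hpq, hqp, (Nat.pow_le_pow_left hqz.le 2).trans_lt hqp,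
          fun _ => hpe⟩⟩
  choose f hf using key
  set s : ℝ → Finset ℕ := fun x => (Nat.primesLE ⌊x⌋₊).filter g with hs
  have hsp : ∀ x, ∀ q ∈ s x, q.Prime := fun x q hq =>
    (Nat.mem_primesLE.1 (Finset.mem_filter.1 hq).1).2
  have hsf : ∀ x, ∀ q ∈ s x, _ := fun x q hq => hf q (hsp x q hq) (Finset.mem_filter.1 hq).2
  refine ⟨fun x => ∏ p ∈ (s x).image f, p, ∑ q ∈ Finset.Icc 1 z, Real.log (f q),
    fun x hx => ⟨?_, ?_⟩⟩
  · have h1 : ∑ q ∈ s x, 1 / (f q : ℝ) ≤ 2 / z := by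
      rw [← Finset.sum_filter_add_sum_filter_not _ (fun q => q ≤ z)]
      have h2 : ∑ q ∈ s x with q ≤ z, 1 / (f q : ℝ) ≤ ∑ q ∈ Finset.Icc 1 z, 1 / (z : ℝ) ^ 2 := by
        refine (Finset.sum_le_sum fun q hq => ?_).trans
          (Finset.sum_le_sum_of_subset_of_nonneg ?_ fun _ _ _ => by positivity)
        · have := (hsf x q (Finset.mem_filter.1 hq).1).2.2.2.1
          have : (z : ℝ) ^ 2 ≤ f q := by exact_mod_cast this.le
          gcongr
        · intro q hq
          rw [Finset.mem_filter] at hq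
          exact Finset.mem_Icc.2 ⟨(hsp x q hq.1).one_le, hq.2⟩
      have h3 : ∑ q ∈ s x with ¬ q ≤ z, 1 / (f q : ℝ) ≤ 1 / z := by
        refine (Finset.sum_le_sum fun q hq => ?_).trans
          (sum_one_div_sq_le_of_forall_lt (by omega) fun q hq =>
            not_le.1 (Finset.mem_filter.1 hq).2)
        rw [Finset.mem_filter] at hq
        have h4 := (hsf x q hq.1).2.2.1
        have h5 : (q : ℝ) ^ 2 ≤ f q := by exact_mod_cast h4.le
        have h6 : (0 : ℝ) < q := by exact_mod_cast (hsp x q hq.1).pos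
        gcongr
      rw [Finset.sum_const, Nat.card_Icc, nsmul_eq_mul, Nat.add_sub_cancel] at h2
      have h4 : (z : ℝ) * (1 / (z : ℝ) ^ 2) = 1 / z := by field_simp
      have h5 : (2 : ℝ) / z = 1 / z + 1 / z := by ring
      linarith
    have h2 : ∑ q ∈ Nat.primesLE ⌊x⌋₊ with ¬ g q, 1 / (q : ℝ) ≤ 2 / z := by
      have hbad : ∀ q ∈ (Nat.primesLE ⌊x⌋₊).filter (fun q => ¬ g q),
          q.Prime ∧ z < q ∧ q ∈ exceptionalModuli b := fun q hq => by
        rw [Finset.mem_filter, hg] at hq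
        push Not at hq
        exact ⟨(Nat.mem_primesLE.1 hq.1).2, hq.2⟩
      refine sum_one_div_le_of_two_mul_lt _ z (by omega) (fun q hq => (hbad q hq).2.1.le)
        fun q hq r hr hqr => ?_
      exact hz₁ q (hbad q hq).2.2 r (hbad r hr).2.2 (hbad q hq).1 (hbad r hr).1
        (((le_max_left _ _).trans hz).trans (hbad q hq).2.1.le) hqr
    have h3 := mul_one_sub_sum_le_prod_filter (Nat.primesLE ⌊x⌋₊) g
      fun q hq => (Nat.mem_primesLE.1 hq).2.ne_zero
    have h4 := mul_prod_one_add_le_dedekindPsi_totient_prod (s x) f (hsp x)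
      (fun q hq => (hsf x q hq).1) (fun q hq => (hsf x q hq).2.1)
    refine le_trans ?_ h4
    have h5 : 0 ≤ primeProd x := Finset.prod_nonneg fun _ _ => by positivity
    have h6 : 0 ≤ 1 - 2 / (z : ℝ) := sub_nonneg.2 ((div_le_one (by linarith)).2 hzR)
    have h7 : primeProd x * (1 - 2 / z) ≤ ∏ q ∈ s x, (1 + 1 / (q : ℝ)) :=
      (mul_le_mul_of_nonneg_left (by linarith) h5).trans h3
    calc (1 - 2 / (z : ℝ)) ^ 2 * primeProd x = (1 - 2 / z) * (primeProd x * (1 - 2 / z)) := by ring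
      _ ≤ _ := mul_le_mul (by linarith) h7 (mul_nonneg h5 h6) (by linarith)
  · refine (log_prod_image_le (s x) f fun q hq => (hsf x q hq).1.ne_zero).trans ?_
    rw [← Finset.sum_filter_add_sum_filter_not _ (fun q => q ≤ z)]
    refine add_le_add (Finset.sum_le_sum_of_subset_of_nonneg (fun q hq => ?_)
      fun _ _ _ => Real.log_natCast_nonneg _) ?_
    · rw [Finset.mem_filter] at hq
      exact Finset.mem_Icc.2 ⟨(hsp x q hq.1).one_le, hq.2⟩
    · have hsub : (s x).filter (fun q => ¬ q ≤ z) ⊆ Finset.Icc 1 ⌊x⌋₊ := fun q hq => by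
        have hq := (Finset.mem_filter.1 (Finset.mem_filter.1 hq).1).1
        rw [Nat.mem_primesLE] at hq
        exact Finset.mem_Icc.2 ⟨hq.2.one_le, hq.1⟩
      calc ∑ q ∈ s x with ¬ q ≤ z, Real.log (f q)
          ≤ ∑ q ∈ s x with ¬ q ≤ z, x ^ (16 * b) := by
            refine Finset.sum_le_sum fun q hq => ?_
            have hqx := (Nat.le_floor_iff hx).1 (Finset.mem_Icc.1 (hsub hq)).2
            rw [Finset.mem_filter, not_le] at hq
            have hfq := hsf x q hq.1
            have h0 : (0 : ℝ) < f q := by exact_mod_cast hfq.1.pos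
            calc Real.log (f q) ≤ (q : ℝ) ^ (16 * b) :=
                  (Real.log_le_iff_le_exp h0).2 (hfq.2.2.2.2 hq.2)
              _ ≤ x ^ (16 * b) := Real.rpow_le_rpow (by positivity) hqx (by positivity)
        _ ≤ ∑ q ∈ Finset.Icc 1 ⌊x⌋₊, x ^ (16 * b) :=
            Finset.sum_le_sum_of_subset_of_nonneg hsub fun _ _ _ => by positivity
        _ = ⌊x⌋₊ * x ^ (16 * b) := by simp
        _ ≤ x * x ^ (16 * b) := by
            gcongr
            exact Nat.floor_le hx

section

open Topology

theorem tendsto_primeProd_atTop : Tendsto primeProd atTop atTop := by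
  have hc : 0 < 6 / Real.pi ^ 2 * Real.exp Real.eulerMascheroniConstant := by positivity
  refine (tendsto_primeProd_div_log.pos_mul_atTop hc Real.tendsto_log_atTop).congr' ?_
  filter_upwards [eventually_gt_atTop 1] with x hx
  exact div_mul_cancel₀ _ (Real.log_pos hx).ne'

theorem tendsto_natCast_of_comp_tendsto_atTop {α : Type*} {l : Filter α} {n : α → ℕ} {F : ℕ → ℝ}
    (hF : ∀ m, 0 ≤ F m) (h : Tendsto (fun x => F (n x)) l atTop) : Tendsto n l atTop := by
  refine tendsto_atTop.2 fun N => ?_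
  filter_upwards [h.eventually_gt_atTop (∑ m ∈ Finset.range N, F m)] with x hx
  by_contra! hlt
  exact absurd hx (not_lt.2 (Finset.single_le_sum (fun m _ => hF m) (Finset.mem_range.2 hlt)))

theorem exists_mul_div_gt {c ε : ℝ} (hc : 0 < c) (hε : 0 < ε) :
    ∃ t : ℝ, 0 < t ∧ t < 1 ∧ t < c ∧ c - ε < (1 - t) ^ 2 * (c - t) / (1 + t) := by
  have hcont : ContinuousAt (fun t : ℝ => (1 - t) ^ 2 * (c - t) / (1 + t)) 0 :=
    ContinuousAt.div (by fun_prop) (by fun_prop) (by norm_num)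
  have h : ∀ᶠ t in 𝓝[>] (0 : ℝ), c - ε < (1 - t) ^ 2 * (c - t) / (1 + t) :=
    (hcont.eventually_const_lt (by norm_num [hε])).filter_mono nhdsWithin_le_nhds
  obtain ⟨t, ht, h0, h1⟩ := (h.and (Ioo_mem_nhdsGT (lt_min one_pos hc))).exists
  exact ⟨t, h0, h1.trans_le (min_le_left _ _), h1.trans_le (min_le_right _ _), ht⟩

theorem eventually_const_add_mul_rpow_le (K : ℝ) {t : ℝ} (ht : 0 < t) :
    ∀ᶠ x : ℝ in atTop, K + x * x ^ (t / 2) ≤ x ^ (1 + t) := by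
  have h1 : Tendsto (fun x : ℝ => x ^ (t / 2)) atTop atTop := tendsto_rpow_atTop (by positivity)
  filter_upwards [eventually_ge_atTop 1, eventually_ge_atTop K, h1.eventually_ge_atTop 2]
    with x hx hK h2
  have h3 : x ^ (1 + t) = x * (x ^ (t / 2) * x ^ (t / 2)) := by
    rw [← Real.rpow_add (by linarith), Real.rpow_add (by linarith), Real.rpow_one, add_halves]
  rw [h3]
  have hx0 : 0 < x := by linarith
  nlinarith [mul_le_mul_of_nonneg_left h2 hx0.le,
    mul_le_mul_of_nonneg_left h2 (by positivity : (0 : ℝ) ≤ x * x ^ (t / 2))]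

theorem frequently_le_dedekindPsi_totient_div {ε : ℝ} (hε : 0 < ε) :
    ∃ᶠ n : ℕ in atTop, 6 / Real.pi ^ 2 * Real.exp Real.eulerMascheroniConstant - ε ≤
      (dedekindPsi (Nat.totient n) : ℝ) / (n * Real.log (Real.log n)) := by
  set c := 6 / Real.pi ^ 2 * Real.exp Real.eulerMascheroniConstant with hc
  have hc0 : 0 < c := by positivity
  obtain ⟨t, ht0, ht1, htc, ht⟩ := exists_mul_div_gt hc0 hε
  obtain ⟨Z, hZ⟩ := exists_natCast_le_dedekindPsi_totient_div (b := t / 32) (by positivity)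
    (by linarith)
  obtain ⟨z, hzZ, hz2, hzt⟩ : ∃ z : ℕ, Z ≤ z ∧ 2 ≤ z ∧ 2 / (z : ℝ) ≤ t := by
    refine ⟨max (max Z 2) ⌈2 / t⌉₊, by simp, by simp, ?_⟩
    have h : 2 / t ≤ (max (max Z 2) ⌈2 / t⌉₊ : ℕ) :=
      (Nat.le_ceil _).trans (by exact_mod_cast le_max_right _ _)
    rw [div_le_iff₀ ht0] at h
    rw [div_le_iff₀ (by positivity)]
    linarith
  obtain ⟨n, K, hn⟩ := hZ z hzZ hz2
  set F : ℕ → ℝ := fun m => (dedekindPsi (Nat.totient m) : ℝ) / m with hF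
  have hlow : ∀ x : ℝ, 0 ≤ x → (1 - t) ^ 2 * primeProd x ≤ F (n x) := fun x hx => by
    refine le_trans ?_ (hn x hx).1
    have : 0 ≤ primeProd x := Finset.prod_nonneg fun _ _ => by positivity
    gcongr
  have hn_atTop : Tendsto n atTop atTop := by
    refine tendsto_natCast_of_comp_tendsto_atTop (F := F) (fun m => by positivity) ?_
    refine tendsto_atTop_mono' _ ?_
      (tendsto_primeProd_atTop.const_mul_atTop (pow_pos (sub_pos.2 ht1) 2))
    filter_upwards [eventually_ge_atTop 0] with x hx using hlow x hx
  have hlog : Tendsto (fun x => Real.log (n x)) atTop atTop :=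
    tendsto_log_natCast_atTop.comp hn_atTop
  refine hn_atTop.frequently (Eventually.frequently ?_)
  filter_upwards [eventually_gt_atTop 1, eventually_const_add_mul_rpow_le K ht0,
    hlog.eventually_gt_atTop 1, tendsto_primeProd_div_log.eventually_const_lt
      (sub_lt_self c ht0)] with x hx hK hl hp
  have hlogx := Real.log_pos hx
  have h1 : Real.log (Real.log (n x)) ≤ (1 + t) * Real.log x := by
    rw [← Real.log_rpow (by linarith)]
    refine Real.log_le_log (by linarith) (((hn x (by linarith)).2).trans ?_)
    rwa [show 16 * (t / 32) = t / 2 by ring]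
  have h2 : 0 < Real.log (Real.log (n x)) := Real.log_pos hl
  rw [← div_div, le_div_iff₀ h2]
  rw [lt_div_iff₀ hlogx] at hp
  have hA : 0 ≤ (1 - t) ^ 2 * (c - t) / (1 + t) :=
    div_nonneg (mul_nonneg (sq_nonneg _) (by linarith)) (by linarith)
  calc (c - ε) * Real.log (Real.log (n x))
      ≤ (1 - t) ^ 2 * (c - t) / (1 + t) * Real.log (Real.log (n x)) := by gcongr
    _ ≤ (1 - t) ^ 2 * (c - t) / (1 + t) * ((1 + t) * Real.log x) := by gcongr
    _ = (1 - t) ^ 2 * ((c - t) * Real.log x) := by field_simp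
    _ ≤ (1 - t) ^ 2 * primeProd x := by gcongr
    _ ≤ F (n x) := hlow x (by linarith)

end

theorem limsup_psi_phi :
    limsup (fun n : ℕ => (dedekindPsi (Nat.totient n) : ℝ) / (n * Real.log (Real.log n))) atTop
      = (6 / Real.pi ^ 2) * Real.exp Real.eulerMascheroniConstant :=
  limsup_eq_of_frequently fun _ hε => frequently_le_dedekindPsi_totient_div hε
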